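/- Let Ω ⊂ ℝ^d (d ≥ 2) be a bounded domain, let I and J be open intervals of ℝ, and let a ∈ C^∞(Ω×I×J, ℝ) and b ∈ C^∞(Ω×I×J, ℝ^d) be bounded. Let v = v(x,t,τ) satisfy, for every τ ∈ J, the equation ∂_t v = Δ_x v + a v + b·∇_x v on Ω×I, extend continuously to the closure of Ω with v = 0 on ∂Ω×I for every τ ∈ J, be C^∞ in (x,t) and of class C^r in τ for some r ≥ 1. Assume there exist no t ∈ I and τ ∈ J such that v(·,t,τ) ≡ 0 on Ω. Then the set {(x₀,t₀) ∈ Ω×I : there exists no τ ∈ J with v(x₀,t₀,τ) = 0 and ∇_x v(x₀,t₀,τ) = 0} is generic (residual) in Ω×I; in other words, the projection onto Ω×I of the singular nodal set {(x,t,τ) : v(x,t,τ) = 0, ∇_x v(x,t,τ) = 0} is contained in a countable union of closed sets with empty interior. -/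

import Mathlib

open Set MeasureTheory

/-- The partial derivative of `f` in the `i`-th coordinate direction. -/
noncomputable def pd {d : ℕ} (i : Fin d) (f : (Fin d → ℝ) → ℝ) (x : Fin d → ℝ) : ℝ :=
  fderiv ℝ f x (Pi.single i 1)

/-- The Laplacian of `f`. -/
noncomputable def lap {d : ℕ} (f : (Fin d → ℝ) → ℝ) (x : Fin d → ℝ) : ℝ :=
  ∑ i, pd i (pd i f) x


/-- Space-time. -/
abbrev XT (d : ℕ) := (Fin d → ℝ) × ℝ

/-- Basis vectors of space-time; `none` is the time direction. -/
noncomputable def bv {d : ℕ} : Option (Fin d) → XT d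
  | some i => (Pi.single i 1, 0)
  | none => (0, 1)

/-- Partial derivative in space-time. -/
noncomputable def dd {d : ℕ} (i : Option (Fin d)) (f : XT d → ℝ) : XT d → ℝ :=
  fun z => fderiv ℝ f z (bv i)

/-- Iterated partial derivatives; the head of the list is the outermost derivative. -/
noncomputable def dw {d : ℕ} : List (Option (Fin d)) → (XT d → ℝ) → XT d → ℝ
  | [], f => f
  | i :: l, f => dd i (dw l f)

abbrev Sm {d : ℕ} (f : XT d → ℝ) (O : Set (XT d)) : Prop := ContDiffOn ℝ (⊤ : ℕ∞) f O

section words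
variable {d : ℕ} {O : Set (XT d)}

theorem Sm.diffAt {f : XT d → ℝ} (hO : IsOpen O) (hf : Sm f O) {z : XT d} (hz : z ∈ O) :
    DifferentiableAt ℝ f z :=
  (hf.contDiffAt (hO.mem_nhds hz)).differentiableAt (by simp)

theorem Sm.dd {f : XT d → ℝ} (hO : IsOpen O) (hf : Sm f O) (i : Option (Fin d)) :
    Sm (dd i f) O := by
  have h := hf.fderiv_of_isOpen (m := (⊤ : ℕ∞)) hO (by simp)
  exact h.clm_apply contDiffOn_const

theorem Sm.dw {f : XT d → ℝ} (hO : IsOpen O) (hf : Sm f O) (l : List (Option (Fin d))) :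
    Sm (dw l f) O := by
  induction l with
  | nil => exact hf
  | cons i l ih => exact ih.dd hO i

theorem dd_congr {f g : XT d → ℝ} (hO : IsOpen O) (h : EqOn f g O) (i : Option (Fin d)) :
    EqOn (dd i f) (dd i g) O := by
  intro z hz
  have : f =ᶠ[nhds z] g := Filter.eventuallyEq_of_mem (hO.mem_nhds hz) h
  simp only [dd, this.fderiv_eq]

theorem dw_congr {f g : XT d → ℝ} (hO : IsOpen O) (h : EqOn f g O) (l : List (Option (Fin d))) :
    EqOn (dw l f) (dw l g) O := by
  induction l with
  | nil => exact h
  | cons i l ih => exact dd_congr hO ih i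

theorem dd_comm {f : XT d → ℝ} (hO : IsOpen O) (hf : Sm f O) (i j : Option (Fin d)) :
    EqOn (dd i (dd j f)) (dd j (dd i f)) O := by
  intro z hz
  have hc := hf.contDiffAt (hO.mem_nhds hz)
  have hs : IsSymmSndFDerivAt ℝ f z := hc.isSymmSndFDerivAt (by simpa using WithTop.coe_le_coe.2 (le_top : (2:ℕ∞) ≤ ⊤))
  have hd' : DifferentiableAt ℝ (fderiv ℝ f) z :=
    ((hc.fderiv_right (m := 1) (by norm_cast)).differentiableAt (by simp))
  have key : ∀ i j : Option (Fin d), dd i (dd j f) z = fderiv ℝ (fderiv ℝ f) z (bv i) (bv j) := by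
    intro i j
    have : dd j f = fun z => fderiv ℝ f z (bv j) := rfl
    rw [dd, this, fderiv_clm_apply hd' (by fun_prop)]
    simp
  rw [key, key]
  exact hs _ _

theorem dw_dd {f : XT d → ℝ} (hO : IsOpen O) (hf : Sm f O) (l : List (Option (Fin d)))
    (i : Option (Fin d)) : EqOn (dw l (dd i f)) (dw (i :: l) f) O := by
  induction l with
  | nil => intro z _; rfl
  | cons j l ih =>
    intro z hz
    have h1 := dd_congr hO ih j hz
    have h2 := dd_comm hO (hf.dw hO l) j i hz
    exact h1.trans h2

theorem dw_snoc {f : XT d → ℝ} (l : List (Option (Fin d)))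
    (i : Option (Fin d)) : dw (l ++ [i]) f = dw l (dd i f) := by
  induction l with
  | nil => rfl
  | cons j l ih => simp only [List.cons_append, dw, ih]

theorem dd_add {f g : XT d → ℝ} (hO : IsOpen O) (hf : Sm f O) (hg : Sm g O)
    (i : Option (Fin d)) :
    EqOn (dd i (fun z => f z + g z)) (fun z => dd i f z + dd i g z) O := by
  intro z hz
  simp only [dd]
  rw [fderiv_fun_add (hf.diffAt hO hz) (hg.diffAt hO hz)]
  simp

theorem dd_mul {f g : XT d → ℝ} (hO : IsOpen O) (hf : Sm f O) (hg : Sm g O)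
    (i : Option (Fin d)) :
    EqOn (dd i (fun z => f z * g z)) (fun z => dd i f z * g z + f z * dd i g z) O := by
  intro z hz
  simp only [dd]
  rw [fderiv_fun_mul (hf.diffAt hO hz) (hg.diffAt hO hz)]
  simp; ring

theorem dw_add {f g : XT d → ℝ} (hO : IsOpen O) (hf : Sm f O) (hg : Sm g O)
    (l : List (Option (Fin d))) :
    EqOn (dw l (fun z => f z + g z)) (fun z => dw l f z + dw l g z) O := by
  induction l with
  | nil => intro z _; rfl
  | cons i l ih =>
    intro z hz
    have h1 := dd_congr hO ih i hz
    exact h1.trans (dd_add hO (hf.dw hO l) (hg.dw hO l) i hz)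

theorem dw_add' {f g : XT d → ℝ} (hO : IsOpen O) (hf : Sm f O) (hg : Sm g O)
    (l : List (Option (Fin d))) {z : XT d} (hz : z ∈ O) :
    dw l (fun z => f z + g z) z = dw l f z + dw l g z := dw_add hO hf hg l hz

theorem dd_zero (i : Option (Fin d)) : dd i (fun _ => (0:ℝ)) = fun _ => 0 := by
  funext z; simp [dd]

theorem dw_zero (l : List (Option (Fin d))) : dw l (fun _ => (0:ℝ)) = fun _ => 0 := by
  induction l with
  | nil => rfl
  | cons i l ih => simp only [dw, ih, dd_zero]

theorem dw_sum {ι : Type*} (s : Finset ι) {f : ι → XT d → ℝ} (hO : IsOpen O)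
    (hf : ∀ i, Sm (f i) O) (l : List (Option (Fin d))) :
    EqOn (dw l (fun z => ∑ i ∈ s, f i z)) (fun z => ∑ i ∈ s, dw l (f i) z) O := by
  classical
  induction s using Finset.induction_on with
  | empty => intro z _; simp [dw_zero]
  | insert i s hi ih =>
    intro z hz
    simp only [Finset.sum_insert hi]
    have hs : Sm (fun z => ∑ i ∈ s, f i z) O := ContDiffOn.sum fun i _ => hf i
    rw [dw_add' hO (hf i) hs l hz, ih hz]

theorem dw_sum' {ι : Type*} (s : Finset ι) {f : ι → XT d → ℝ} (hO : IsOpen O)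
    (hf : ∀ i, Sm (f i) O) (l : List (Option (Fin d))) {z : XT d} (hz : z ∈ O) :
    dw l (fun z => ∑ i ∈ s, f i z) z = ∑ i ∈ s, dw l (f i) z := dw_sum s hO hf l hz

/-- All derivatives of order `< k` vanish on `A`. -/
def Van (k : ℕ) (f : XT d → ℝ) (A : Set (XT d)) : Prop :=
  ∀ l : List (Option (Fin d)), l.length < k → ∀ z ∈ A, dw l f z = 0

theorem van_succ {k : ℕ} {f : XT d → ℝ} {A : Set (XT d)} :
    Van (k + 1) f A ↔ (∀ z ∈ A, f z = 0) ∧ ∀ i, Van k (dd i f) A := by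
  constructor
  · intro h
    refine ⟨fun z hz => h [] (by simp) z hz, fun i l hl z hz => ?_⟩
    rw [← dw_snoc]
    exact h _ (by simpa using hl) z hz
  · rintro ⟨h0, h1⟩ l hl z hz
    rcases List.eq_nil_or_concat l with rfl | ⟨l', i, rfl⟩
    · exact h0 z hz
    · rw [List.concat_eq_append, dw_snoc]
      exact h1 i l' (by simpa using hl) z hz

theorem Van.mono {k k' : ℕ} {f : XT d → ℝ} {A : Set (XT d)} (h : Van k f A) (hk : k' ≤ k) :
    Van k' f A := fun l hl => h l (hl.trans_le hk)

theorem Van.congr {k : ℕ} {f g : XT d → ℝ} {A : Set (XT d)} (hO : IsOpen O) (hA : A ⊆ O)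
    (h : Van k f A) (hfg : EqOn f g O) : Van k g A :=
  fun l hl z hz => (dw_congr hO hfg l (hA hz)).symm.trans (h l hl z hz)

theorem Van.add {k : ℕ} {f g : XT d → ℝ} {A : Set (XT d)} (hO : IsOpen O) (hA : A ⊆ O)
    (sf : Sm f O) (sg : Sm g O) (hf : Van k f A) (hg : Van k g A) :
    Van k (fun z => f z + g z) A := by
  intro l hl z hz
  rw [dw_add' hO sf sg l (hA hz), hf l hl z hz, hg l hl z hz, add_zero]

theorem Van.sum {k : ℕ} {ι : Type*} {s : Finset ι} {f : ι → XT d → ℝ} {A : Set (XT d)}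
    (hO : IsOpen O) (hA : A ⊆ O)
    (sf : ∀ i, Sm (f i) O) (hf : ∀ i, Van k (f i) A) :
    Van k (fun z => ∑ i ∈ s, f i z) A := by
  intro l hl z hz
  rw [dw_sum' s hO sf l (hA hz)]
  exact Finset.sum_eq_zero fun i _ => hf i l hl z hz

theorem Van.mul {k : ℕ} {A : Set (XT d)} (hO : IsOpen O) (hA : A ⊆ O) :
    ∀ {f g : XT d → ℝ}, Sm f O → Sm g O → Van k g A → Van k (fun z => f z * g z) A := by
  induction k with
  | zero => intro f g _ _ _ l hl; simp at hl
  | succ k ih =>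
    intro f g sf sg hg
    have hgs := van_succ.1 hg
    refine van_succ.2 ⟨fun z hz => by simp [hgs.1 z hz], fun i => ?_⟩
    have e := dd_mul hO sf sg i
    refine Van.congr hO hA ?_ e.symm
    exact Van.add hO hA ((sf.dd hO i).mul sg) (sf.mul (sg.dd hO i))
      (ih (sf.dd hO i) sg (hg.mono (by omega))) (ih sf (sg.dd hO i) (hgs.2 i))

/-- The parabolic equation in space-time form. -/
def PDE (f a : XT d → ℝ) (b : Fin d → XT d → ℝ) (O : Set (XT d)) : Prop :=
  ∀ z ∈ O, dd none f z = ∑ i, dd (some i) (dd (some i) f) z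
    + a z * f z + ∑ i, b i z * dd (some i) f z

theorem pde_word {f a : XT d → ℝ} {b : Fin d → XT d → ℝ} (hO : IsOpen O)
    (hf : Sm f O) (ha : Sm a O) (hb : ∀ i, Sm (b i) O) (h : PDE f a b O)
    (l : List (Option (Fin d))) {z : XT d} (hz : z ∈ O) :
    dw (none :: l) f z = ∑ i, dw (some i :: some i :: l) f z
      + dw l (fun z => a z * f z) z + ∑ i, dw l (fun z => b i z * dd (some i) f z) z := by
  have s1 : Sm (fun z => ∑ i : Fin d, dd (some i) (dd (some i) f) z) O :=
    ContDiffOn.sum fun i _ => (hf.dd hO _).dd hO _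
  have s2 : Sm (fun z => a z * f z) O := ha.mul hf
  have s3' : ∀ i, Sm (fun z => b i z * dd (some i) f z) O := fun i => (hb i).mul (hf.dd hO _)
  have s3 : Sm (fun z => ∑ i, b i z * dd (some i) f z) O :=
    ContDiffOn.sum fun i _ => s3' i
  have e : EqOn (dd none f) (fun z => ∑ i, dd (some i) (dd (some i) f) z
    + a z * f z + ∑ i, b i z * dd (some i) f z) O := h
  rw [← dw_dd hO hf l none hz, dw_congr hO e l hz, dw_add' hO (s1.add s2) s3 l hz,
    dw_add' hO s1 s2 l hz, dw_sum' _ hO (fun i => (hf.dd hO _).dd hO _) l hz,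
    dw_sum' _ hO s3' l hz]
  congr 2
  refine Finset.sum_congr rfl fun i _ => ?_
  rw [dw_dd hO (hf.dd hO _) l _ hz]
  exact dd_congr hO (dw_dd hO hf l (some i)) _ hz

theorem two_words {f a : XT d → ℝ} {b : Fin d → XT d → ℝ} (hO : IsOpen O)
    (hf : Sm f O) (ha : Sm a O) (hb : ∀ i, Sm (b i) O) (h : PDE f a b O)
    {z : XT d} (hz : z ∈ O) (h0 : f z = 0) (h1 : ∀ i, dd (some i) f z = 0)
    (hn : ∃ l, dw l f z ≠ 0) :
    ∃ l1 l2 : List (Option (Fin d)), ∃ i j, dw l1 f z = 0 ∧ dw l2 f z = 0 ∧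
      dw (i :: l1) f z * dw (j :: l2) f z - dw (j :: l1) f z * dw (i :: l2) f z ≠ 0 := by
  classical
  have hex : ∃ k : ℕ, ∃ l : List (Option (Fin d)), l.length = k ∧ dw l f z ≠ 0 := by
    obtain ⟨l, hl⟩ := hn; exact ⟨_, l, rfl, hl⟩
  set k := Nat.find hex with hk
  obtain ⟨l0, hl0, hl0n⟩ := Nat.find_spec hex
  rw [← hk] at hl0
  have hmin : ∀ l : List (Option (Fin d)), l.length < k → dw l f z = 0 := by
    intro l hl
    by_contra hc
    exact Nat.find_min hex hl ⟨l, rfl, hc⟩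
  have hV : Van k f {z} := by
    rintro l hl z' rfl; exact hmin l hl
  have hA : ({z} : Set (XT d)) ⊆ O := by simpa using hz
  have haf : ∀ l : List (Option (Fin d)), l.length < k → dw l (fun z => a z * f z) z = 0 :=
    fun l hl => Van.mul hO hA ha hf hV l hl z rfl
  have hbf : ∀ (k' : ℕ) i, Van k' (dd (some i) f) {z} → ∀ l : List (Option (Fin d)),
      l.length < k' → dw l (fun z => b i z * dd (some i) f z) z = 0 :=
    fun k' i hv l hl => Van.mul hO hA (hb i) (hf.dd hO _) hv l hl z rfl
  by_cases hc : ∃ (i : Fin d) (m : List (Option (Fin d))), m.length + 1 = k ∧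
      dw (some i :: m) f z ≠ 0
  · obtain ⟨i, m, hm, hne⟩ := hc
    cases m with
    | nil => exact absurd (h1 i) hne
    | cons c η =>
      by_contra hcon
      push Not at hcon
      simp only [List.length_cons] at hm
      have hq : ∀ x y, dw (x :: y :: η) f z = dw (y :: x :: η) f z :=
        fun x y => dd_comm hO (hf.dw hO η) x y hz
      have hH : ∀ x y, dw (x :: y :: η) f z * dw (some i :: c :: η) f z =
          dw (some i :: y :: η) f z * dw (x :: c :: η) f z := by
        intro x y
        have := hcon (y :: η) (c :: η) x (some i) (hmin _ (by simp; omega))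
          (hmin _ (by simp; omega))
        linarith
      have hsum : ∑ j : Fin d, dw (some j :: some j :: η) f z = 0 := by
        have hp := pde_word hO hf ha hb h η hz
        have e1 : dw (none :: η) f z = 0 := hmin _ (by simp; omega)
        have e2 := haf η (by omega)
        have e3 : ∑ i, dw η (fun z => b i z * dd (some i) f z) z = 0 :=
          Finset.sum_eq_zero fun i _ => hbf (k - 1) i
            ((van_succ.1 (hV.mono (k' := k - 1 + 1) (by omega))).2 _) η (by omega)
        rw [e1, e2, e3] at hp
        linarith
      set L := dw (some i :: c :: η) f z with hL
      have hall : ∀ x y, dw (x :: y :: η) f z * L ^ 2 =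
          dw (some i :: some i :: η) f z * (dw (x :: c :: η) f z * dw (y :: c :: η) f z) := by
        intro x y
        have e1 := hH x y
        have e2 := hH y (some i)
        rw [hq y (some i)] at e2
        calc dw (x :: y :: η) f z * L ^ 2 = (dw (x :: y :: η) f z * L) * L := by ring
          _ = dw (some i :: y :: η) f z * dw (x :: c :: η) f z * L := by rw [e1]
          _ = (dw (some i :: y :: η) f z * L) * dw (x :: c :: η) f z := by ring
          _ = _ := by rw [e2]; ring
      have hs2 : dw (some i :: some i :: η) f z *
          ∑ j : Fin d, (dw (some j :: c :: η) f z) ^ 2 = 0 := by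
        rw [Finset.mul_sum]
        have : ∀ j : Fin d, dw (some i :: some i :: η) f z * (dw (some j :: c :: η) f z) ^ 2
            = dw (some j :: some j :: η) f z * L ^ 2 := by
          intro j; rw [hall]; ring
        rw [Finset.sum_congr rfl fun j _ => this j, ← Finset.sum_mul, hsum, zero_mul]
      have hpos : 0 < ∑ j : Fin d, (dw (some j :: c :: η) f z) ^ 2 := by
        refine lt_of_lt_of_le (b := L ^ 2) (by positivity) ?_
        exact Finset.single_le_sum (f := fun j : Fin d => (dw (some j :: c :: η) f z) ^ 2)
          (fun j _ => sq_nonneg _) (Finset.mem_univ i)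
      have hz0 : dw (some i :: some i :: η) f z = 0 := by
        rcases mul_eq_zero.1 hs2 with h | h
        · exact h
        · exact absurd h hpos.ne'
      have := hall (some i) c
      rw [hz0, zero_mul] at this
      have h3 : L ^ 3 = 0 := by rw [← this, hL]; ring
      exact hne (pow_eq_zero_iff (by norm_num) |>.1 h3)
  · push Not at hc
    cases l0 with
    | nil => exact absurd h0 hl0n
    | cons c m =>
      simp only [List.length_cons] at hl0
      cases c with
      | some i => exact absurd (hc i m hl0) hl0n
      | none =>
        have hp := pde_word hO hf ha hb h m hz
        have e2 := haf m (by omega)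
        have e3 : ∑ i, dw m (fun z => b i z * dd (some i) f z) z = 0 := by
          refine Finset.sum_eq_zero fun i _ => hbf k i ?_ m (by omega)
          rintro l hl z' rfl
          rw [dw_dd hO hf l _ hz]
          by_cases hlk : l.length + 1 = k
          · exact hc i l hlk
          · exact hmin _ (by simp; omega)
        rw [e2, e3, add_zero, add_zero] at hp
        have : ∃ i : Fin d, dw (some i :: some i :: m) f z ≠ 0 := by
          by_contra hcon
          push Not at hcon
          rw [Finset.sum_eq_zero fun i _ => hcon i] at hp
          exact hl0n hp
        obtain ⟨i, hi⟩ := this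
        refine ⟨m, some i :: m, none, some i, hmin _ (by omega), hc i m hl0, ?_⟩
        rw [hc i m hl0, zero_mul, sub_zero]
        exact mul_ne_zero hl0n hi

theorem dd_some_eq_zero {h : XT d → ℝ} {U : Set (Fin d → ℝ)} (hU : IsOpen U) {t0 : ℝ}
    {x : Fin d → ℝ} (hx : x ∈ U) (hd : DifferentiableAt ℝ h (x, t0))
    (hz : ∀ y ∈ U, h (y, t0) = 0) (i : Fin d) : dd (some i) h (x, t0) = 0 := by
  have h1 : HasFDerivAt (fun y : Fin d → ℝ => h (y, t0))
      ((fderiv ℝ h (x, t0)).comp (ContinuousLinearMap.inl ℝ (Fin d → ℝ) ℝ)) x := by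
    exact HasFDerivAt.comp (f := fun y : Fin d → ℝ => (y, t0)) x hd.hasFDerivAt
      (hasFDerivAt_prodMk_left x t0)
  have h2 : HasFDerivAt (fun y : Fin d → ℝ => h (y, t0)) (0 : (Fin d → ℝ) →L[ℝ] ℝ) x := by
    refine (hasFDerivAt_const (0:ℝ) x).congr_of_eventuallyEq ?_
    filter_upwards [hU.mem_nhds hx] with y hy using hz y hy
  have := DFunLike.congr_fun (h1.unique h2) (Pi.single i 1)
  simpa [dd, bv] using this

theorem slice_van {f a : XT d → ℝ} {b : Fin d → XT d → ℝ} (hO : IsOpen O)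
    (hf : Sm f O) (ha : Sm a O) (hb : ∀ i, Sm (b i) O) (h : PDE f a b O)
    {U : Set (Fin d → ℝ)} (hU : IsOpen U) {t0 : ℝ} (hA : U ×ˢ {t0} ⊆ O)
    (h0 : ∀ x ∈ U, f (x, t0) = 0) (k : ℕ) : Van k f (U ×ˢ {t0}) := by
  have hsp : ∀ {k} {g : XT d → ℝ}, Sm g O → Van k g (U ×ˢ {t0}) → ∀ i,
      Van k (dd (some i) g) (U ×ˢ {t0}) := by
    rintro k g sg hg i l hl ⟨x, t⟩ ⟨hx, ht⟩
    obtain rfl : t = t0 := ht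
    rw [dw_dd hO sg l _ (hA ⟨hx, rfl⟩)]
    exact dd_some_eq_zero hU hx ((sg.dw hO l).diffAt hO (hA ⟨hx, rfl⟩))
      (fun y hy => hg l hl _ ⟨hy, rfl⟩) i
  induction k with
  | zero => intro l hl; simp at hl
  | succ k ih =>
    refine van_succ.2 ⟨?_, ?_⟩
    · rintro ⟨x, t⟩ ⟨hx, ht⟩
      obtain rfl : t = t0 := ht
      exact h0 x hx
    · rintro (_ | i)
      · have e : EqOn (dd none f) (fun z => ∑ i, dd (some i) (dd (some i) f) z
          + a z * f z + ∑ i, b i z * dd (some i) f z) O := h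
        refine Van.congr hO hA ?_ e.symm
        have s1 : ∀ i : Fin d, Sm (dd (some i) (dd (some i) f)) O :=
          fun i => (hf.dd hO _).dd hO _
        have s3 : ∀ i, Sm (fun z => b i z * dd (some i) f z) O :=
          fun i => (hb i).mul (hf.dd hO _)
        have s1' : Sm (fun z => ∑ i : Fin d, dd (some i) (dd (some i) f) z) O :=
          ContDiffOn.sum fun i _ => s1 i
        refine Van.add hO hA (s1'.add (ha.mul hf)) (ContDiffOn.sum fun i _ => s3 i)
          (Van.add hO hA s1' (ha.mul hf) ?_ ?_) ?_
        · exact Van.sum hO hA s1 fun i => hsp (hf.dd hO _) (hsp hf ih i) i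
        · exact Van.mul hO hA ha hf ih
        · exact Van.sum hO hA s3 fun i => Van.mul hO hA (hb i) (hf.dd hO _) (hsp hf ih i)
      · exact hsp hf ih i

end words



section carleman
variable {d : ℕ}

/-- Gaussian weight. -/
noncomputable def gam (y : Fin d → ℝ) : ℝ := Real.exp (-(∑ i, y i ^ 2) / 4)

theorem gam_pos (y : Fin d → ℝ) : 0 < gam y := Real.exp_pos _

theorem gam_contDiff : ContDiff ℝ (⊤ : ℕ∞) (gam : (Fin d → ℝ) → ℝ) := by
  unfold gam; fun_prop

theorem gam_fderiv (y : Fin d → ℝ) (i : Fin d) :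
    fderiv ℝ gam y (Pi.single i 1) = -(y i / 2) * gam y := by
  have h : HasFDerivAt (gam : (Fin d → ℝ) → ℝ)
      (gam y • ((-1/4 : ℝ) • ∑ j, (2 * y j) • ContinuousLinearMap.proj (R := ℝ) (φ := fun _ : Fin d => ℝ) j)) y := by
    unfold gam
    refine HasFDerivAt.exp ?_
    have : (fun y : Fin d → ℝ => -(∑ i, y i ^ 2) / 4) = fun y => (-1/4 : ℝ) • ∑ i, y i ^ 2 := by
      funext y; simp; ring
    rw [this]
    refine HasFDerivAt.const_smul (f := fun y : Fin d → ℝ => ∑ i, y i ^ 2) (HasFDerivAt.fun_sum (A := fun (i : Fin d) (y : Fin d → ℝ) => y i ^ 2) fun j _ => ?_) (-1/4 : ℝ)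
    have h0 : HasFDerivAt (fun y : Fin d → ℝ => y j)
      (ContinuousLinearMap.proj (R := ℝ) (φ := fun _ : Fin d => ℝ) j) y := hasFDerivAt_apply j y
    simpa using h0.pow 2
  rw [h.fderiv]
  simp [Pi.single_apply]
  ring

theorem Sm.contDiff {f : XT d → ℝ} (h : Sm f univ) : ContDiff ℝ (⊤ : ℕ∞) f := contDiffOn_univ.1 h

theorem Sm.slice {f : XT d → ℝ} (h : Sm f univ) (θ : ℝ) :
    ContDiff ℝ (⊤ : ℕ∞) (fun y => f (y, θ)) := h.contDiff.comp (by fun_prop)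

theorem fderiv_slice {f : XT d → ℝ} {y : Fin d → ℝ} {θ : ℝ}
    (h : DifferentiableAt ℝ f (y, θ)) (i : Fin d) :
    fderiv ℝ (fun y => f (y, θ)) y (Pi.single i 1) = dd (some i) f (y, θ) := by
  have h1 : HasFDerivAt (fun y : Fin d → ℝ => f (y, θ))
      ((fderiv ℝ f (y, θ)).comp (ContinuousLinearMap.inl ℝ (Fin d → ℝ) ℝ)) y :=
    HasFDerivAt.comp (f := fun y : Fin d → ℝ => (y, θ)) y h.hasFDerivAt
      (hasFDerivAt_prodMk_left y θ)
  rw [h1.fderiv]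
  simp [dd, bv]

theorem hasDerivAt_slice {f : XT d → ℝ} {y : Fin d → ℝ} {θ : ℝ}
    (h : DifferentiableAt ℝ f (y, θ)) :
    HasDerivAt (fun s => f (y, s)) (dd none f (y, θ)) θ := by
  have h1 : HasFDerivAt (fun s : ℝ => f (y, s))
      ((fderiv ℝ f (y, θ)).comp (ContinuousLinearMap.inr ℝ (Fin d → ℝ) ℝ)) θ :=
    HasFDerivAt.comp (f := fun s : ℝ => (y, s)) θ h.hasFDerivAt
      (hasFDerivAt_prodMk_right y θ)
  have := h1.hasDerivAt
  simpa [dd, bv] using this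

/-- Locally uniform compact support in `y`, for positive times. -/
def LS (f : XT d → ℝ) : Prop := ∀ θ0 > 0, ∃ ρ : ℝ, ∀ θ > θ0, ∀ y, ρ < ‖y‖ → f (y, θ) = 0

theorem LS.dd {f : XT d → ℝ} (h : LS f) (i : Option (Fin d)) : LS (dd i f) := by
  intro θ0 h0
  obtain ⟨ρ, hρ⟩ := h θ0 h0
  refine ⟨ρ, fun θ hθ y hy => ?_⟩
  have hO : IsOpen {q : XT d | θ0 < q.2 ∧ ρ < ‖q.1‖} :=
    IsOpen.and (isOpen_lt continuous_const continuous_snd)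
      (isOpen_lt continuous_const continuous_fst.norm)
  have := dd_congr (f := f) (g := fun _ => 0) hO (fun q hq => hρ q.2 hq.1 q.1 hq.2) i
    (show (y, θ) ∈ _ from ⟨hθ, hy⟩)
  rw [this, dd_zero]

theorem LS.mul_left {f : XT d → ℝ} (h : LS f) (g : XT d → ℝ) : LS (fun q => g q * f q) := by
  intro θ0 h0
  obtain ⟨ρ, hρ⟩ := h θ0 h0
  exact ⟨ρ, fun θ hθ y hy => by simp [hρ θ hθ y hy]⟩

theorem LS.mul_right {f : XT d → ℝ} (h : LS f) (g : XT d → ℝ) : LS (fun q => f q * g q) := by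
  intro θ0 h0
  obtain ⟨ρ, hρ⟩ := h θ0 h0
  exact ⟨ρ, fun θ hθ y hy => by simp [hρ θ hθ y hy]⟩

theorem LS.add {f g : XT d → ℝ} (h : LS f) (h' : LS g) : LS (fun q => f q + g q) := by
  intro θ0 h0
  obtain ⟨ρ, hρ⟩ := h θ0 h0
  obtain ⟨ρ', hρ'⟩ := h' θ0 h0
  exact ⟨max ρ ρ', fun θ hθ y hy => by
    show f (y, θ) + g (y, θ) = 0
    rw [hρ θ hθ y ((le_max_left _ _).trans_lt hy), hρ' θ hθ y ((le_max_right _ _).trans_lt hy),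
      add_zero]⟩

theorem LS.sum {ι : Type*} (s : Finset ι) {f : ι → XT d → ℝ} (h : ∀ i, LS (f i)) :
    LS (fun q => ∑ i ∈ s, f i q) := by
  classical
  induction s using Finset.induction_on with
  | empty => intro θ0 _; exact ⟨0, by simp⟩
  | insert i s hi ih =>
    simp only [Finset.sum_insert hi]
    exact (h i).add ih

theorem LS.hcs {f : XT d → ℝ} (h : LS f) {θ : ℝ} (hθ : 0 < θ) :
    HasCompactSupport (fun y => f (y, θ)) := by
  obtain ⟨ρ, hρ⟩ := h (θ/2) (by positivity)
  refine HasCompactSupport.intro (isCompact_closedBall (0 : Fin d → ℝ) ρ) fun y hy => ?_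
  exact hρ θ (by linarith) y (by simpa using hy)

theorem LS.integrable {f : XT d → ℝ} (h : LS f) (hf : Continuous f) {θ : ℝ} (hθ : 0 < θ) :
    Integrable (fun y => f (y, θ)) :=
  (hf.comp (by fun_prop : Continuous fun y : Fin d → ℝ => (y, θ))).integrable_of_hasCompactSupport
    (h.hcs hθ)

theorem LS.hasDerivAt {f : XT d → ℝ} (h : LS f) (hf : Sm f univ) {θ : ℝ} (hθ : 0 < θ) :
    HasDerivAt (fun θ => ∫ y, f (y, θ)) (∫ y, _root_.dd none f (y, θ)) θ := by
  obtain ⟨ρ, hρ⟩ := (h.dd none) (θ/2) (by positivity)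
  have hc : Continuous (_root_.dd none f) := (hf.dd isOpen_univ none).contDiff.continuous
  obtain ⟨C, hC⟩ := ((isCompact_closedBall (0 : Fin d → ℝ) ρ).prod
    (isCompact_Icc (a := θ/2) (b := 2*θ))).exists_bound_of_continuousOn hc.continuousOn
  refine (hasDerivAt_integral_of_dominated_loc_of_deriv_le (F := fun θ y => f (y, θ))
    (F' := fun θ y => _root_.dd none f (y, θ))
    (bound := (Metric.closedBall (0 : Fin d → ℝ) ρ).indicator fun _ => C)
    (Ioo_mem_nhds (by linarith : θ/2 < θ) (by linarith : θ < 2*θ)) ?_ (h.integrable hf.contDiff.continuous hθ)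
    ?_ ?_ ?_ ?_).2
  · exact Filter.Eventually.of_forall fun s => (hf.slice s).continuous.aestronglyMeasurable
  · exact ((hf.dd isOpen_univ none).slice θ).continuous.aestronglyMeasurable
  · refine Filter.Eventually.of_forall fun y s hs => ?_
    by_cases hy : y ∈ Metric.closedBall (0 : Fin d → ℝ) ρ
    · rw [indicator_of_mem hy]
      exact hC (y, s) ⟨hy, hs.1.le, hs.2.le⟩
    · rw [indicator_of_notMem hy, hρ s hs.1 y (by simpa using hy), norm_zero]
  · exact (integrable_indicator_iff Metric.isClosed_closedBall.measurableSet).2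
      (integrableOn_const (isCompact_closedBall _ _).measure_lt_top.ne)
  · exact Filter.Eventually.of_forall fun y s _ => hasDerivAt_slice (hf.diffAt isOpen_univ (mem_univ _))

theorem ibp {f h : XT d → ℝ} (sf : Sm f univ) (sh : Sm h univ) (hf : LS f) {θ : ℝ} (hθ : 0 < θ)
    (i : Fin d) :
    ∫ y, dd (some i) f (y, θ) * dd (some i) h (y, θ) * gam y =
      - ∫ y, (dd (some i) (dd (some i) f) (y, θ) - y i / 2 * dd (some i) f (y, θ))
        * h (y, θ) * gam y := by
  have sf1 := sf.dd isOpen_univ (some i)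
  have sf2 := sf1.dd isOpen_univ (some i)
  have cg : Continuous (gam : (Fin d → ℝ) → ℝ) := gam_contDiff.continuous
  have c1 := sf1.contDiff.continuous
  have c2 := sf2.contDiff.continuous
  have ch := sh.contDiff.continuous
  have ch1 := (sh.dd isOpen_univ (some i)).contDiff.continuous
  have e1 : ∀ y, fderiv ℝ (fun y => h (y, θ)) y (Pi.single i 1) = dd (some i) h (y, θ) :=
    fun y => fderiv_slice (sh.diffAt isOpen_univ (mem_univ _)) i
  have e2 : ∀ y, fderiv ℝ (fun y => dd (some i) f (y, θ) * gam y) y (Pi.single i 1) =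
      (dd (some i) (dd (some i) f) (y, θ) - y i / 2 * dd (some i) f (y, θ)) * gam y := by
    intro y
    rw [fderiv_fun_mul ((sf1.slice θ).differentiable (by simp) y)
      (gam_contDiff.differentiable (by simp) y)]
    have := fderiv_slice (θ := θ) (sf1.diffAt isOpen_univ (mem_univ (y, θ))) i
    simp [gam_fderiv, this]
    ring
  have k1 := (hf.dd (some i)).hcs hθ
  have k2 := ((hf.dd (some i)).dd (some i)).hcs hθ
  have := integral_mul_fderiv_eq_neg_fderiv_mul_of_integrable (μ := (volume : Measure (Fin d → ℝ)))
    (f := fun y => dd (some i) f (y, θ) * gam y) (g := fun y => h (y, θ)) (v := Pi.single i 1)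
    ?_ ?_ ?_ ?_ ?_
  · simp only [e1, e2] at this
    rw [← integral_congr_ae (μ := volume) (Filter.Eventually.of_forall fun y => ?_),
      this]
    · congr 1
      refine integral_congr_ae (Filter.Eventually.of_forall fun y => ?_)
      dsimp only; ring
    · ring
  · simp only [e2]
    refine Continuous.integrable_of_hasCompactSupport (by fun_prop) ?_
    have : HasCompactSupport (fun y : Fin d → ℝ => (dd (some i) (dd (some i) f) (y, θ) - y i / 2 * dd (some i) f (y, θ))) := by
      refine HasCompactSupport.sub (f := fun y : Fin d → ℝ => dd (some i) (dd (some i) f) (y, θ))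
        (f' := fun y => y i / 2 * dd (some i) f (y, θ)) k2 ?_
      exact k1.mul_left (f := fun y : Fin d → ℝ => y i / 2)
    exact (this.mul_right (f' := gam)).mul_right
  · simp only [e1]
    refine Continuous.integrable_of_hasCompactSupport (by fun_prop) ?_
    exact (k1.mul_right (f' := gam)).mul_right
  · refine Continuous.integrable_of_hasCompactSupport (by fun_prop) ?_
    exact (k1.mul_right (f' := gam)).mul_right
  · intro y _
    exact ((sf1.slice θ).mul gam_contDiff).differentiable (by simp) y
  · intro y _
    exact (sh.slice θ).differentiable (by simp) y

/-- The Ornstein-Uhlenbeck operator. -/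
noncomputable def ou (f : XT d → ℝ) (q : XT d) : ℝ :=
  ∑ i, (dd (some i) (dd (some i) f) q - q.1 i / 2 * dd (some i) f q)

noncomputable def HH (f : XT d → ℝ) (θ : ℝ) : ℝ := ∫ y, f (y, θ) ^ 2 * gam y
noncomputable def DD (f : XT d → ℝ) (θ : ℝ) : ℝ :=
  ∫ y, (∑ i, dd (some i) f (y, θ) ^ 2) * gam y

theorem ou_sm {f : XT d → ℝ} (sf : Sm f univ) : Sm (ou f) univ := by
  refine ContDiffOn.sum fun i _ => ((sf.dd isOpen_univ _).dd isOpen_univ _).sub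
    (ContDiffOn.mul (ContDiff.contDiffOn (by fun_prop)) (sf.dd isOpen_univ _))

theorem gam_sm : Sm (fun q : XT d => gam q.1) univ :=
  (gam_contDiff.comp contDiff_fst).contDiffOn

theorem ibp_sum {f h : XT d → ℝ} (sf : Sm f univ) (sh : Sm h univ) (hf : LS f) {θ : ℝ} (hθ : 0 < θ) :
    ∫ y, (∑ i, dd (some i) f (y, θ) * dd (some i) h (y, θ)) * gam y =
      - ∫ y, ou f (y, θ) * h (y, θ) * gam y := by
  have cg : Continuous (fun q : XT d => gam q.1) := gam_sm.contDiff.continuous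
  have c1 := fun i => (sf.dd isOpen_univ (some i)).contDiff.continuous
  have c2 := fun i => ((sf.dd isOpen_univ (some i)).dd isOpen_univ (some i)).contDiff.continuous
  have ch := sh.contDiff.continuous
  have ch1 := fun i => (sh.dd isOpen_univ (some i)).contDiff.continuous
  simp only [ou, Finset.sum_mul]
  rw [integral_finsetSum, integral_finsetSum, ← Finset.sum_neg_distrib]
  · exact Finset.sum_congr rfl fun i _ => ibp sf sh hf hθ i
  · intro i _
    have h1 : LS (fun q : XT d => (dd (some i) (dd (some i) f) q - q.1 i / 2 * dd (some i) f q)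
        * h q * gam q.1) := by
      have := (((((hf.dd (some i)).dd (some i)).add ((hf.dd (some i)).mul_left
        (fun q => - (q.1 i / 2)))).mul_right h).mul_right (fun q => gam q.1))
      convert this using 4
      ring
    exact h1.integrable (by fun_prop) hθ
  · intro i _
    have h1 := ((hf.dd (some i)).mul_right (dd (some i) h)).mul_right (fun q => gam q.1)
    exact h1.integrable (by fun_prop) hθ

theorem HH_deriv {f : XT d → ℝ} (sf : Sm f univ) (hf : LS f) {θ : ℝ} (hθ : 0 < θ) :
    HasDerivAt (HH f) (2 * ∫ y, f (y, θ) * dd none f (y, θ) * gam y) θ := by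
  have h1 : LS (fun q : XT d => f q ^ 2 * gam q.1) := by
    have := (hf.mul_right f).mul_right (fun q => gam q.1)
    convert this using 3
    ring
  have s1 : Sm (fun q : XT d => f q ^ 2 * gam q.1) univ := (sf.pow 2).mul gam_sm
  have := h1.hasDerivAt s1 hθ
  refine HasDerivAt.congr_deriv this (Eq.symm ?_)
  rw [← integral_const_mul]
  refine integral_congr_ae (Filter.Eventually.of_forall fun y => ?_)
  have a1 := hasDerivAt_slice (s1.diffAt isOpen_univ (mem_univ (y, θ)))
  have a2 := ((hasDerivAt_slice (sf.diffAt isOpen_univ (mem_univ (y, θ)))).pow 2).mul_const (gam y)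
  have := a1.unique a2
  simp only [this]
  simp; ring

theorem DD_deriv {f : XT d → ℝ} (sf : Sm f univ) (hf : LS f) {θ : ℝ} (hθ : 0 < θ) :
    HasDerivAt (DD f) (-2 * ∫ y, ou f (y, θ) * dd none f (y, θ) * gam y) θ := by
  have h1 : LS (fun q : XT d => (∑ i, dd (some i) f q ^ 2) * gam q.1) := by
    refine LS.mul_right (LS.sum _ fun i => ?_) _
    have := ((hf.dd (some i)).mul_right (dd (some i) f))
    convert this using 3
    ring
  have s1 : Sm (fun q : XT d => (∑ i, dd (some i) f q ^ 2) * gam q.1) univ :=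
    (ContDiffOn.sum fun i _ => (sf.dd isOpen_univ _).pow 2).mul gam_sm
  have := h1.hasDerivAt s1 hθ
  refine HasDerivAt.congr_deriv this (Eq.symm ?_)
  have e := ibp_sum sf (sf.dd isOpen_univ none) hf hθ
  rw [neg_mul, ← mul_neg, ← e, ← integral_const_mul]
  refine integral_congr_ae (Filter.Eventually.of_forall fun y => ?_)
  have a1 := hasDerivAt_slice (s1.diffAt isOpen_univ (mem_univ (y, θ)))
  have a2 := (HasDerivAt.fun_sum (u := Finset.univ) fun (i : Fin d) _ => (hasDerivAt_slice
    ((sf.dd isOpen_univ (some i)).diffAt isOpen_univ (mem_univ (y, θ)))).pow 2).mul_const (gam y)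
  have := a1.unique a2
  simp only [this]
  rw [← mul_assoc, Finset.mul_sum]
  congr 1
  refine Finset.sum_congr rfl fun i _ => ?_
  rw [dd_comm isOpen_univ sf none (some i) (mem_univ _)]
  simp; ring

theorem DD_eq {f : XT d → ℝ} (sf : Sm f univ) (hf : LS f) {θ : ℝ} (hθ : 0 < θ) :
    DD f θ = - ∫ y, ou f (y, θ) * f (y, θ) * gam y := by
  rw [← ibp_sum sf sf hf hθ, DD]
  simp only [pow_two]

theorem LS.ou {f : XT d → ℝ} (hf : LS f) : LS (ou f) := by
  refine LS.sum _ fun i => ?_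
  have := ((hf.dd (some i)).dd (some i)).add ((hf.dd (some i)).mul_left (fun q => - (q.1 i / 2)))
  convert this using 2
  ring

/-- The Carleman core inequality. -/
theorem core_ineq {f : XT d → ℝ} (sf : Sm f univ) (hf : LS f) {θ : ℝ} (hθ : 0 < θ) (κ : ℝ) :
    θ * (-2 * ∫ y, ou f (y, θ) * dd none f (y, θ) * gam y)
      - θ * κ * (2 * ∫ y, f (y, θ) * dd none f (y, θ) * gam y)
    ≥ 4 * κ * (DD f θ - κ * HH f θ)
      - 1 / 4 * ∫ y, (θ * dd none f (y, θ) + 2 * ou f (y, θ)) ^ 2 * gam y := by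
  have cg : Continuous (fun q : XT d => gam q.1) := gam_sm.contDiff.continuous
  have c0 := sf.contDiff.continuous
  have c1 := (sf.dd isOpen_univ none).contDiff.continuous
  have c2 := (ou_sm sf).contDiff.continuous
  have i1 : Integrable (fun y => ou f (y, θ) * dd none f (y, θ) * gam y) :=
    ((hf.ou.mul_right (dd none f)).mul_right (fun q => gam q.1)).integrable (by fun_prop) hθ
  have i2 : Integrable (fun y => f (y, θ) * dd none f (y, θ) * gam y) :=
    ((hf.mul_right (dd none f)).mul_right (fun q => gam q.1)).integrable (by fun_prop) hθ
  have i3 : Integrable (fun y => ou f (y, θ) * f (y, θ) * gam y) :=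
    ((hf.ou.mul_right f).mul_right (fun q => gam q.1)).integrable (by fun_prop) hθ
  have i4 : Integrable (fun y => f (y, θ) ^ 2 * gam y) := by
    have := ((hf.mul_right f).mul_right (fun q => gam q.1)).integrable (by fun_prop) hθ
    simpa only [pow_two] using this
  have i5 : Integrable (fun y => (θ * dd none f (y, θ) + 2 * ou f (y, θ)) ^ 2 * gam y) := by
    have h1 := ((hf.dd none).mul_left (fun _ => θ)).add (hf.ou.mul_left (fun _ => 2))
    have := ((h1.mul_right (fun q => θ * dd none f q + 2 * ou f q)).mul_right
      (fun q => gam q.1)).integrable (by fun_prop) hθ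
    simpa only [pow_two] using this
  rw [DD_eq sf hf hθ, HH, ge_iff_le, ← sub_nonneg]
  have e : θ * (-2 * ∫ y, ou f (y, θ) * dd none f (y, θ) * gam y)
      - θ * κ * (2 * ∫ y, f (y, θ) * dd none f (y, θ) * gam y)
      - (4 * κ * ((- ∫ y, ou f (y, θ) * f (y, θ) * gam y) - κ * ∫ y, f (y, θ) ^ 2 * gam y)
      - 1 / 4 * ∫ y, (θ * dd none f (y, θ) + 2 * ou f (y, θ)) ^ 2 * gam y)
      = ∫ y, ((-2 * θ) * (ou f (y, θ) * dd none f (y, θ) * gam y)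
        + (-2 * θ * κ) * (f (y, θ) * dd none f (y, θ) * gam y)
        + (4 * κ) * (ou f (y, θ) * f (y, θ) * gam y) + (4 * κ ^ 2) * (f (y, θ) ^ 2 * gam y)
        + 1 / 4 * ((θ * dd none f (y, θ) + 2 * ou f (y, θ)) ^ 2 * gam y)) := by
    rw [integral_add, integral_add, integral_add, integral_add, integral_const_mul,
      integral_const_mul, integral_const_mul, integral_const_mul, integral_const_mul]
    · ring
    all_goals
      first
      | exact Integrable.const_mul (by assumption) _
      | (repeat' apply Integrable.add) <;> exact Integrable.const_mul (by assumption) _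
  rw [e]
  refine integral_nonneg fun y => ?_
  have hg := (gam_pos y).le
  have : (-2 * θ) * (ou f (y, θ) * dd none f (y, θ) * gam y)
        + (-2 * θ * κ) * (f (y, θ) * dd none f (y, θ) * gam y)
        + (4 * κ) * (ou f (y, θ) * f (y, θ) * gam y) + (4 * κ ^ 2) * (f (y, θ) ^ 2 * gam y)
        + 1 / 4 * ((θ * dd none f (y, θ) + 2 * ou f (y, θ)) ^ 2 * gam y)
      = (2 * (ou f (y, θ) + κ * f (y, θ)) - (θ * dd none f (y, θ) + 2 * ou f (y, θ)) / 2) ^ 2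
        * gam y := by ring
  simp only [Pi.zero_apply]
  rw [this]
  positivity

end carleman



theorem ode_lemma {H D H' D' : ℝ → ℝ} {θ0 K : ℝ} (hθ0 : 0 < θ0) (hK : 0 < K)
    (hKθ : K * θ0 ^ 2 ≤ 1 / 4)
    (hH : ∀ θ ∈ Ioc 0 θ0, HasDerivAt H (H' θ) θ) (hD : ∀ θ ∈ Ioc 0 θ0, HasDerivAt D (D' θ) θ)
    (hH0 : ∀ θ, 0 ≤ H θ) (hD0 : ∀ θ, 0 ≤ D θ)
    (hineq : ∀ θ ∈ Ioc 0 θ0, ∀ κ : ℝ, 4 * κ * (D θ - κ * H θ) - 1 / 4 * (K * θ ^ 2 * (H θ + D θ))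
      ≤ θ * D' θ - θ * κ * H' θ)
    (hdec : ∀ N : ℕ, ∃ C : ℝ, ∀ θ ∈ Ioc 0 θ0, H θ ≤ C * θ ^ N) : H θ0 = 0 := by
  have main : ∀ n : ℕ, 1 ≤ n → (n : ℝ) * H θ0 ≤ 2 * D θ0 := by
    intro n hn
    have hn' : (1 : ℝ) ≤ n := by exact_mod_cast hn
    set Φ : ℝ → ℝ := fun θ => (1 + K * θ ^ 2) * ((θ ^ (4 * n))⁻¹ * Real.exp (4 * n * K * θ ^ 2))
      * (D θ - n * (1 - 2 * K * θ ^ 2) * H θ) with hΦ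
    have hder : ∀ θ ∈ Ioc 0 θ0, ∃ c, 0 ≤ c ∧ HasDerivAt Φ c θ := by
      intro θ hθ
      have hθp : 0 < θ := hθ.1
      set W := (θ ^ (4 * n))⁻¹ * Real.exp (4 * n * K * θ ^ 2) with hW
      have hWp : 0 < W := by positivity
      have hp : HasDerivAt (fun θ : ℝ => 1 + K * θ ^ 2) (2 * K * θ) θ := by
        have := ((hasDerivAt_pow 2 θ).const_mul K).const_add 1
        refine this.congr_deriv ?_
        simp; ring
      have hk : HasDerivAt (fun θ : ℝ => n * (1 - 2 * K * θ ^ 2)) (-4 * n * K * θ) θ := by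
        have := (((hasDerivAt_pow 2 θ).const_mul (2 * K)).const_sub 1).const_mul (n : ℝ)
        refine this.congr_deriv ?_
        simp; ring
      have hw1 : HasDerivAt (fun θ : ℝ => (θ ^ (4 * n))⁻¹) (-(4 * n / θ) * (θ ^ (4 * n))⁻¹) θ := by
        have := (hasDerivAt_pow (4 * n) θ).inv (by positivity)
        refine this.congr_deriv ?_
        have h4 : θ ^ (4 * n) = θ ^ (4 * n - 1) * θ := by
          rw [← pow_succ]; congr 1; omega
        rw [h4]
        push_cast
        field_simp
      have hw2 : HasDerivAt (fun θ : ℝ => Real.exp (4 * n * K * θ ^ 2))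
          (Real.exp (4 * n * K * θ ^ 2) * (8 * n * K * θ)) θ := by
        have := ((hasDerivAt_pow 2 θ).const_mul (4 * n * K)).exp
        refine this.congr_deriv ?_
        simp; ring
      have hw : HasDerivAt (fun θ : ℝ => (θ ^ (4 * n))⁻¹ * Real.exp (4 * n * K * θ ^ 2))
          (-(4 * (n * (1 - 2 * K * θ ^ 2)) / θ) * W) θ := by
        refine (hw1.mul hw2).congr_deriv ?_
        rw [hW]
        field_simp
        ring
      refine ⟨_, ?_, (hp.mul hw).mul ((hD θ hθ).sub (hk.mul (hH θ hθ)))⟩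
      simp only [Pi.mul_apply, Pi.sub_apply]
      rw [← hW]
      set κ := (n : ℝ) * (1 - 2 * K * θ ^ 2) with hκ
      have h1 := hineq θ hθ κ
      set h := H θ
      set e := D θ
      have hKt : K * θ ^ 2 ≤ 1 / 4 := by
        refine le_trans ?_ hKθ
        have : θ ^ 2 ≤ θ0 ^ 2 := by gcongr; exact hθ.2
        gcongr
      have hKt0 : 0 ≤ K * θ ^ 2 := by positivity
      have h2 : 4 * κ * (e - κ * h) / θ - 1 / 4 * (K * θ * (h + e)) ≤ D' θ - κ * H' θ := by
        have : 4 * κ * (e - κ * h) / θ - 1 / 4 * (K * θ * (h + e))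
          = (4 * κ * (e - κ * h) - 1 / 4 * (K * θ ^ 2 * (h + e))) / θ := by
          field_simp
        rw [this, div_le_iff₀ hθp]
        linarith
      have hpp : 0 < 1 + K * θ ^ 2 := by positivity
      have hh : 0 ≤ h := hH0 θ
      have he : 0 ≤ e := hD0 θ
      have key : 0 ≤ 2 * K * θ * (e - κ * h) + (1 + K * θ ^ 2) *
          (4 * n * K * θ * h - 1 / 4 * (K * θ * (h + e))) := by
        have : 2 * K * θ * (e - κ * h) + (1 + K * θ ^ 2) *
          (4 * n * K * θ * h - 1 / 4 * (K * θ * (h + e)))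
          = K * θ * (e * (2 - (1 + K * θ ^ 2) / 4) +
            h * (2 * n + 8 * n * (K * θ ^ 2) - (1 + K * θ ^ 2) / 4)) := by
          rw [hκ]; ring
        rw [this]
        have q1 : 0 ≤ 2 - (1 + K * θ ^ 2) / 4 := by linarith
        have q2 : 0 ≤ 2 * n + 8 * n * (K * θ ^ 2) - (1 + K * θ ^ 2) / 4 := by
          have : 0 ≤ 8 * n * (K * θ ^ 2) := by positivity
          linarith
        positivity
      have h3 := mul_le_mul_of_nonneg_left h2 hpp.le
      have : (2 * K * θ * W + (1 + K * θ ^ 2) * (-(4 * κ / θ) * W)) * (e - κ * h) +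
          (1 + K * θ ^ 2) * W * (D' θ - (-4 * n * K * θ * h + κ * H' θ))
          = W * (2 * K * θ * (e - κ * h) + (1 + K * θ ^ 2) * (4 * n * K * θ * h)
            + ((1 + K * θ ^ 2) * (D' θ - κ * H' θ)
              - (1 + K * θ ^ 2) * (4 * κ * (e - κ * h) / θ))) := by
        field_simp
        ring
      rw [this]
      refine mul_nonneg hWp.le ?_
      linarith
    choose! Φ' hΦ'0 hΦ' using hder
    have hmono : ∀ ε ∈ Ioc 0 θ0, Φ ε ≤ Φ θ0 := by
      intro ε hε
      have hm : MonotoneOn Φ (Icc ε θ0) := by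
        refine monotoneOn_of_hasDerivWithinAt_nonneg (f' := Φ') (convex_Icc _ _) ?_ ?_ ?_
        · exact fun x hx => (hΦ' x ⟨hε.1.trans_le hx.1, hx.2⟩).continuousAt.continuousWithinAt
        · intro x hx
          rw [interior_Icc] at hx
          exact (hΦ' x ⟨hε.1.trans hx.1, hx.2.le⟩).hasDerivWithinAt
        · intro x hx
          rw [interior_Icc] at hx
          exact hΦ'0 x ⟨hε.1.trans hx.1, hx.2.le⟩
      exact hm ⟨le_rfl, hε.2⟩ ⟨hε.2, le_rfl⟩ hε.2
    obtain ⟨C, hC⟩ := hdec (4 * n + 1)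
    have hlow : ∀ ε ∈ Ioc 0 θ0, -(2 * Real.exp n * n * C * ε) ≤ Φ ε := by
      intro ε hε
      have hεp := hε.1
      have hKt : K * ε ^ 2 ≤ 1 / 4 := by
        refine le_trans ?_ hKθ
        have : ε ^ 2 ≤ θ0 ^ 2 := by gcongr; exact hε.2
        gcongr
      have hKt0 : 0 ≤ K * ε ^ 2 := by positivity
      have hCe := hC ε hε
      have e1 : Real.exp (4 * n * K * ε ^ 2) ≤ Real.exp n := by
        apply Real.exp_le_exp.2; nlinarith
      have e2 : -(n * H ε) ≤ D ε - n * (1 - 2 * K * ε ^ 2) * H ε := by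
        have := hD0 ε
        have := hH0 ε
        have : 0 ≤ n * (K * ε ^ 2) * H ε := by positivity
        nlinarith
      have e3 : (ε ^ (4 * n))⁻¹ * H ε ≤ C * ε := by
        rw [inv_mul_le_iff₀ (by positivity)]
        refine hCe.trans (le_of_eq ?_); ring
      have e3' : 0 ≤ (ε ^ (4 * n))⁻¹ * H ε := by
        have := hH0 ε; positivity
      have hpos : 0 ≤ (1 + K * ε ^ 2) * ((ε ^ (4 * n))⁻¹ * Real.exp (4 * n * K * ε ^ 2)) := by
        positivity
      have := mul_le_mul_of_nonneg_left e2 hpos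
      refine le_trans ?_ this
      have e4 : (1 + K * ε ^ 2) * Real.exp (4 * n * K * ε ^ 2) * n * ((ε ^ (4 * n))⁻¹ * H ε)
          ≤ 2 * Real.exp n * n * (C * ε) := by
        gcongr
        linarith
      have e5 : (1 + K * ε ^ 2) * ((ε ^ (4 * n))⁻¹ * Real.exp (4 * n * K * ε ^ 2)) * -(n * H ε)
        = -((1 + K * ε ^ 2) * Real.exp (4 * n * K * ε ^ 2) * n * ((ε ^ (4 * n))⁻¹ * H ε)) := by
        ring
      rw [e5]; linarith
    have hΦ0 : 0 ≤ Φ θ0 := by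
      have ht : Filter.Tendsto (fun ε : ℝ => -(2 * Real.exp n * n * C * ε)) (nhdsWithin 0 (Ioi 0))
          (nhds 0) := by
        have : Continuous (fun ε : ℝ => -(2 * Real.exp n * n * C * ε)) := by fun_prop
        have := (this.tendsto 0).mono_left (nhdsWithin_le_nhds (s := Ioi 0))
        simpa using this
      refine le_of_tendsto ht ?_
      filter_upwards [Ioc_mem_nhdsGT hθ0] with ε hε
      exact (hlow ε hε).trans (hmono ε hε)
    have hpos : 0 < (1 + K * θ0 ^ 2) * ((θ0 ^ (4 * n))⁻¹ * Real.exp (4 * n * K * θ0 ^ 2)) := by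
      positivity
    have h1 := nonneg_of_mul_nonneg_right hΦ0 hpos
    have h2 := hH0 θ0
    have h3 : (n : ℝ) * (1/2) * H θ0 ≤ n * (1 - 2 * K * θ0 ^ 2) * H θ0 := by
      gcongr; linarith
    linarith
  by_contra hne
  have hpos : 0 < H θ0 := lt_of_le_of_ne (hH0 _) (Ne.symm hne)
  obtain ⟨n, hn⟩ := exists_nat_gt (2 * D θ0 / H θ0)
  have := main (n + 1) (by omega)
  rw [div_lt_iff₀ hpos] at hn
  push_cast at this
  linarith


section suc
variable {d : ℕ}

theorem clm_basis (L : XT d →L[ℝ] ℝ) (z : XT d) :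
    L z = z.2 * L (bv none) + ∑ i, z.1 i * L (bv (some i)) := by
  have h : z = z.2 • bv none + ∑ i, z.1 i • bv (some i) := by
    ext j
    · simp [bv, Prod.fst_sum, Finset.sum_apply, Pi.single_apply]
    · simp [bv, Prod.snd_sum]
  conv_lhs => rw [h]
  simp [map_add, map_sum]

theorem fderiv_norm_le (f : XT d → ℝ) (w : XT d) :
    ‖fderiv ℝ f w‖ ≤ ∑ i : Option (Fin d), |dd i f w| := by
  refine ContinuousLinearMap.opNorm_le_bound _ (by positivity) fun z => ?_
  rw [clm_basis, Fintype.sum_option, add_mul, Finset.sum_mul]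
  refine (norm_add_le _ _).trans (add_le_add ?_ ((norm_sum_le _ _).trans (Finset.sum_le_sum fun i _ => ?_)))
  · rw [norm_mul, mul_comm]
    exact mul_le_mul_of_nonneg_left (norm_snd_le z) (abs_nonneg _)
  · rw [norm_mul, mul_comm]
    exact mul_le_mul_of_nonneg_left ((norm_le_pi_norm _ i).trans (norm_fst_le z)) (abs_nonneg _)

theorem hcs_dd {f : XT d → ℝ} (h : HasCompactSupport f) (i : Option (Fin d)) :
    HasCompactSupport (dd i f) := by
  have := h.fderiv (𝕜 := ℝ)
  exact this.comp_left (g := fun L : XT d →L[ℝ] ℝ => L (bv i)) rfl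

theorem decay (N : ℕ) : ∀ {f : XT d → ℝ}, Sm f univ → HasCompactSupport f → (∀ l, dw l f 0 = 0) →
    ∃ C : ℝ, 0 ≤ C ∧ ∀ z, |f z| ≤ C * ‖z‖ ^ N := by
  induction N with
  | zero =>
    intro f sf hf _
    obtain ⟨C, hC⟩ := sf.contDiff.continuous.bounded_above_of_compact_support hf
    exact ⟨C, (norm_nonneg _).trans (hC 0), fun z => by simpa using hC z⟩
  | succ N ih =>
    intro f sf hf h0
    have : ∀ i, ∃ C : ℝ, 0 ≤ C ∧ ∀ z, |dd i f z| ≤ C * ‖z‖ ^ N := fun i =>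
      ih (sf.dd isOpen_univ i) (hcs_dd hf i) fun l => by
        have := h0 (l ++ [i])
        rwa [dw_snoc] at this
    choose C hC0 hC using this
    refine ⟨∑ i, C i, Finset.sum_nonneg fun i _ => hC0 i, fun z => ?_⟩
    have hb : ∀ w ∈ Metric.closedBall (0 : XT d) ‖z‖, ‖fderiv ℝ f w‖ ≤ (∑ i, C i) * ‖z‖ ^ N := by
      intro w hw
      refine (fderiv_norm_le f w).trans ?_
      rw [Finset.sum_mul]
      refine Finset.sum_le_sum fun i _ => (hC i w).trans ?_
      gcongr
      · exact hC0 i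
      · simpa using hw
    have := (convex_closedBall (0 : XT d) ‖z‖).norm_image_sub_le_of_norm_fderiv_le (𝕜 := ℝ)
      (fun w _ => sf.diffAt isOpen_univ (mem_univ w)) hb (x := 0) (y := z) (by simp) (by simp)
    rw [show f 0 = 0 from h0 []] at this
    simp only [sub_zero, Real.norm_eq_abs] at this
    rw [pow_succ]; linarith

end suc


section suc2
variable {d : ℕ}

noncomputable def e8 (y : Fin d → ℝ) : ℝ := Real.exp (-(∑ i, y i ^ 2) / 8)

theorem e8_pos (y : Fin d → ℝ) : 0 < e8 y := Real.exp_pos _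

theorem gam_eq (y : Fin d → ℝ) : gam y = e8 y * e8 y := by
  rw [gam, e8, ← Real.exp_add]; congr 1; ring

theorem e8_int : Integrable (e8 : (Fin d → ℝ) → ℝ) := by
  have h : Integrable (fun y : Fin d → ℝ => ∏ i, Real.exp (-(1/8) * (y i) ^ 2)) :=
    Integrable.fintype_prod (f := fun _ : Fin d => fun x : ℝ => Real.exp (-(1/8) * x ^ 2))
      (fun _ => integrable_exp_neg_mul_sq (by norm_num))
  convert h using 2 with y
  rw [← Real.exp_sum, e8, ← Finset.mul_sum]; congr 1; ring

theorem norm_sq_le_sum (y : Fin d → ℝ) : ‖y‖ ^ 2 ≤ ∑ i, y i ^ 2 := by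
  have h0 : 0 ≤ ∑ i, y i ^ 2 := Finset.sum_nonneg fun i _ => sq_nonneg _
  have : ‖y‖ ≤ Real.sqrt (∑ i, y i ^ 2) := by
    refine (pi_norm_le_iff_of_nonneg (Real.sqrt_nonneg _)).2 fun i => Real.abs_le_sqrt ?_
    exact Finset.single_le_sum (f := fun i => y i ^ 2) (fun i _ => sq_nonneg _) (Finset.mem_univ i)
  calc ‖y‖ ^ 2 ≤ (Real.sqrt (∑ i, y i ^ 2)) ^ 2 := by gcongr
    _ = _ := Real.sq_sqrt h0

theorem sum_le_norm_sq (y : Fin d → ℝ) : ∑ i, y i ^ 2 ≤ d * ‖y‖ ^ 2 := by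
  have : ∑ i, y i ^ 2 ≤ ∑ _i : Fin d, ‖y‖ ^ 2 := Finset.sum_le_sum fun i _ => by
    rw [← sq_abs]; gcongr; exact norm_le_pi_norm y i
  simpa using this

theorem pow_mul_gam (N : ℕ) : ∃ C : ℝ, 0 ≤ C ∧ ∀ y : Fin d → ℝ,
    ((1 + ‖y‖) ^ N) ^ 2 * gam y ≤ C * e8 y := by
  refine ⟨2 ^ N * (8 ^ N * N.factorial * Real.exp (1/8)), by positivity, fun y => ?_⟩
  set s := ∑ i, y i ^ 2 with hs
  have h0 : 0 ≤ s := Finset.sum_nonneg fun i _ => sq_nonneg _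
  have h1 : ((1 + ‖y‖) ^ N) ^ 2 ≤ 2 ^ N * (1 + s) ^ N := by
    rw [← pow_mul, mul_comm, pow_mul, ← mul_pow]
    gcongr
    have := norm_sq_le_sum y
    nlinarith [sq_nonneg (1 - ‖y‖)]
  have h2 : (1 + s) ^ N ≤ 8 ^ N * N.factorial * Real.exp (1/8) * Real.exp (s / 8) := by
    have := Real.pow_div_factorial_le_exp ((1+s)/8) (by positivity) N
    rw [div_le_iff₀ (by positivity), div_pow, div_le_iff₀ (by positivity)] at this
    rw [mul_assoc, ← Real.exp_add]
    refine this.trans_eq ?_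
    rw [show (1:ℝ)/8 + s/8 = (1+s)/8 by ring]; ring
  have h3 : Real.exp (s / 8) * e8 y = 1 := by
    rw [e8, ← Real.exp_add, ← hs, show s / 8 + -s / 8 = 0 by ring, Real.exp_zero]
  rw [gam_eq]
  have he := e8_pos y
  calc ((1 + ‖y‖) ^ N) ^ 2 * (e8 y * e8 y) ≤ 2 ^ N * (8 ^ N * N.factorial * Real.exp (1/8) * Real.exp (s / 8)) * (e8 y * e8 y) := by
        gcongr; exact h1.trans (by gcongr)
    _ = 2 ^ N * (8 ^ N * N.factorial * Real.exp (1/8)) * (Real.exp (s / 8) * e8 y) * e8 y := by ring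
    _ = _ := by rw [h3]; ring

/-- Parabolic blow-up. -/
def gg (U : XT d → ℝ) : XT d → ℝ := fun q => U (q.2 • q.1, q.2 ^ 2)

theorem gg_sm {U : XT d → ℝ} (h : Sm U univ) : Sm (gg U) univ :=
  (h.contDiff.comp (g := U) (f := fun q : XT d => ((q.2 • q.1, q.2 ^ 2) : XT d)) (by fun_prop)).contDiffOn

theorem gg_ls {U : XT d → ℝ} (h : HasCompactSupport U) : LS (gg U) := by
  intro θ0 h0
  obtain ⟨ρ, hρ⟩ := h.isCompact.isBounded.subset_closedBall 0
  refine ⟨|ρ| / θ0, fun θ hθ y hy => ?_⟩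
  by_contra hne
  have : (θ • y, θ ^ 2) ∈ Metric.closedBall (0 : XT d) ρ := hρ (subset_tsupport _ hne)
  rw [mem_closedBall_zero_iff] at this
  have h1 := (norm_fst_le (θ • y, θ ^ 2)).trans this
  simp only [norm_smul, Real.norm_eq_abs] at h1
  rw [div_lt_iff₀ h0] at hy
  have h2 : ‖y‖ * θ0 ≤ |θ| * ‖y‖ := by
    rw [mul_comm, abs_of_pos (h0.trans hθ)]; gcongr
  linarith [le_abs_self ρ]

theorem gg_dd {U : XT d → ℝ} (h : Sm U univ) (y : Fin d → ℝ) (θ : ℝ) (i : Fin d) :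
    dd (some i) (gg U) (y, θ) = θ * gg (dd (some i) U) (y, θ) := by
  rw [← fderiv_slice ((gg_sm h).diffAt isOpen_univ (mem_univ _))]
  have h1 : HasFDerivAt (fun y : Fin d → ℝ => ((θ • y, θ ^ 2) : XT d))
      ((θ • ContinuousLinearMap.id ℝ (Fin d → ℝ)).prod 0) y :=
    ((hasFDerivAt_id y).const_smul θ).prodMk (hasFDerivAt_const _ _)
  have h2 := ((h.diffAt isOpen_univ (mem_univ ((θ • y, θ ^ 2) : XT d))).hasFDerivAt).comp y h1
  have h3 : (fun y => gg U (y, θ)) = (U ∘ fun y : Fin d → ℝ => ((θ • y, θ ^ 2) : XT d)) := rfl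
  rw [h3, h2.fderiv]
  simp only [ContinuousLinearMap.comp_apply, gg, dd, bv]
  rw [← smul_eq_mul, ← map_smul]
  congr 1
  ext <;> simp

theorem gg_dn {U : XT d → ℝ} (h : Sm U univ) (y : Fin d → ℝ) (θ : ℝ) :
    dd none (gg U) (y, θ) = ∑ i, y i * gg (dd (some i) U) (y, θ) + 2 * θ * gg (dd none U) (y, θ) := by
  have h0 := hasDerivAt_slice ((gg_sm h).diffAt isOpen_univ (mem_univ (y, θ)))
  have h1 : HasDerivAt (fun s : ℝ => ((s • y, s ^ 2) : XT d)) (y, 2 * θ) θ := by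
    have a := (hasDerivAt_id θ).smul_const y
    have b := hasDerivAt_pow 2 θ
    have := a.prodMk b
    simpa using this
  have h2 := ((h.diffAt isOpen_univ (mem_univ ((θ • y, θ ^ 2) : XT d))).hasFDerivAt).comp_hasDerivAt θ h1
  rw [h0.unique h2, clm_basis]
  simp only [gg, dd]
  ring

theorem gg_dd2 {U : XT d → ℝ} (h : Sm U univ) (y : Fin d → ℝ) (θ : ℝ) (i : Fin d) :
    dd (some i) (dd (some i) (gg U)) (y, θ) = θ ^ 2 * gg (dd (some i) (dd (some i) U)) (y, θ) := by
  have hs := h.dd isOpen_univ (some i)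
  rw [← fderiv_slice (((gg_sm h).dd isOpen_univ _).diffAt isOpen_univ (mem_univ _))]
  simp only [gg_dd h]
  rw [fderiv_const_mul]
  · rw [_root_.smul_apply, fderiv_slice ((gg_sm hs).diffAt isOpen_univ (mem_univ _)), gg_dd hs, smul_eq_mul]
    ring
  · exact ((gg_sm hs).slice θ).differentiable (by simp) y

theorem gg_F {U : XT d → ℝ} (h : Sm U univ) (y : Fin d → ℝ) (θ : ℝ) :
    θ * dd none (gg U) (y, θ) + 2 * ou (gg U) (y, θ)
     = 2 * θ ^ 2 * gg (fun z => dd none U z + ∑ i, dd (some i) (dd (some i) U) z) (y, θ) := by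
  rw [gg_dn h, ou]
  simp only [gg_dd2 h, gg_dd h, Finset.sum_sub_distrib]
  simp only [gg, mul_add, Finset.mul_sum]
  have : ∀ i, 2 * (y i / 2 * (θ * dd (some i) U (θ • y, θ ^ 2)))
    = θ * (y i * dd (some i) U (θ • y, θ ^ 2)) := fun i => by ring
  rw [mul_sub, Finset.mul_sum, Finset.mul_sum]
  simp only [this]
  have : ∀ i, 2 * (θ ^ 2 * dd (some i) (dd (some i) U) (θ • y, θ ^ 2))
    = 2 * θ ^ 2 * dd (some i) (dd (some i) U) (θ • y, θ ^ 2) := fun i => by ring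
  simp only [this]
  ring

end suc2


section suc3
variable {d : ℕ}

theorem F_bound {U : XT d → ℝ} (sU : Sm U univ) (cU : HasCompactSupport U) {R T M C0 : ℝ}
    (hR : 0 < R)
    (hM : 0 ≤ M)
    (hPDE : ∀ z : XT d, ‖z.1‖ < R → 0 < z.2 → z.2 < T →
      |dd none U z + ∑ i, dd (some i) (dd (some i) U) z| ≤ M * (|U z| + ∑ i, |dd (some i) U z|))
    (hC0 : ∀ z : XT d, |dd none U z + ∑ i, dd (some i) (dd (some i) U) z| ≤ C0)
    {θ : ℝ} (hθ : 0 < θ) (hθ1 : θ ≤ 1) (hθT : θ ^ 2 < T) :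
    ∫ y, (θ * dd none (gg U) (y, θ) + 2 * ou (gg U) (y, θ)) ^ 2 * gam y ≤
      4 * M ^ 2 * (d + 1) * θ ^ 2 * (HH (gg U) θ + DD (gg U) θ)
        + 4 * θ ^ 4 * C0 ^ 2 * Real.exp (-(R ^ 2 / (8 * θ ^ 2))) * ∫ y : Fin d → ℝ, e8 y := by
  have sg := gg_sm sU
  have lg := gg_ls cU
  have i1 : Integrable (fun y => (gg U (y, θ)) ^ 2 * gam y) := by
    have : LS (fun q : XT d => gg U q ^ 2 * gam q.1) := by
      have := (lg.mul_right (gg U)).mul_right (fun q => gam q.1)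
      convert this using 3
      ring
    exact this.integrable (((sg.contDiff.continuous).pow 2).mul gam_sm.contDiff.continuous) hθ
  have i2 : Integrable (fun y => (∑ i, dd (some i) (gg U) (y, θ) ^ 2) * gam y) := by
    have : LS (fun q : XT d => (∑ i, dd (some i) (gg U) q ^ 2) * gam q.1) := by
      refine LS.mul_right (LS.sum _ fun i => ?_) _
      have := ((lg.dd (some i)).mul_right (dd (some i) (gg U)))
      convert this using 2
      ring
    refine this.integrable (Continuous.mul (continuous_finsetSum _ fun i _ => ?_) gam_sm.contDiff.continuous) hθ
    exact (sg.dd isOpen_univ _).contDiff.continuous.pow 2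
  rw [HH, DD, ← integral_add i1 i2, ← integral_const_mul, ← integral_const_mul, ← integral_add]
  rotate_left
  · exact (i1.add i2).const_mul _
  · exact e8_int.const_mul _
  refine integral_mono_of_nonneg (.of_forall fun y => mul_nonneg (sq_nonneg _) (gam_pos y).le)
    (((i1.add i2).const_mul _).add (e8_int.const_mul _)) (.of_forall fun y => ?_)
  simp only [gg_F sU, gg_dd sU]
  set z : XT d := (θ • y, θ ^ 2) with hz
  simp only [gg, ← hz]
  set A := dd none U z + ∑ i, dd (some i) (dd (some i) U) z with hA
  have hg := gam_pos y
  have he := e8_pos y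
  have hS : 0 ≤ ∑ i, dd (some i) U z ^ 2 := Finset.sum_nonneg fun i _ => sq_nonneg _
  by_cases hy : ‖z.1‖ < R
  · have h1 := hPDE z hy (by simp [hz]; positivity) hθT
    have h2 : A ^ 2 ≤ M ^ 2 * ((d + 1) * (U z ^ 2 + ∑ i, dd (some i) U z ^ 2)) := by
      have h3 : A ^ 2 ≤ (M * (|U z| + ∑ i, |dd (some i) U z|)) ^ 2 := by
        rw [← sq_abs A]; gcongr
      refine h3.trans ?_
      rw [mul_pow]
      gcongr
      have := sq_sum_le_card_mul_sum_sq (s := (Finset.univ : Finset (Option (Fin d))))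
        (f := fun o => o.elim (|U z|) (fun i => |dd (some i) U z|))
      simpa [Fintype.sum_option] using this
    have h4 : (θ * dd none U z * 0) = 0 := by ring
    have h5 : ∑ i, (θ * dd (some i) U z) ^ 2 = θ ^ 2 * ∑ i, dd (some i) U z ^ 2 := by
      rw [Finset.mul_sum]; simp only [mul_pow]
    rw [h5]
    have h6 : θ ^ 2 ≤ 1 := by nlinarith
    have h7 : (2 * θ ^ 2 * A) ^ 2 ≤ 4 * M ^ 2 * (d + 1) * θ ^ 2 * (U z ^ 2 + θ ^ 2 * ∑ i, dd (some i) U z ^ 2) := by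
      have h8 : θ ^ 4 * (U z ^ 2 + ∑ i, dd (some i) U z ^ 2) ≤ θ ^ 2 * (U z ^ 2 + θ ^ 2 * ∑ i, dd (some i) U z ^ 2) := by
        have : θ ^ 4 * U z ^ 2 ≤ θ ^ 2 * U z ^ 2 := by
          have : θ ^ 4 ≤ θ ^ 2 := by nlinarith [sq_nonneg θ]
          gcongr
        nlinarith
      calc (2 * θ ^ 2 * A) ^ 2 = 4 * θ ^ 4 * A ^ 2 := by ring
        _ ≤ 4 * θ ^ 4 * (M ^ 2 * ((d + 1) * (U z ^ 2 + ∑ i, dd (some i) U z ^ 2))) := by gcongr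
        _ = 4 * M ^ 2 * (d + 1) * (θ ^ 4 * (U z ^ 2 + ∑ i, dd (some i) U z ^ 2)) := by ring
        _ ≤ 4 * M ^ 2 * (d + 1) * (θ ^ 2 * (U z ^ 2 + θ ^ 2 * ∑ i, dd (some i) U z ^ 2)) := by gcongr
        _ = _ := by ring
    have h9 : (0:ℝ) ≤ 4 * θ ^ 4 * C0 ^ 2 * Real.exp (-(R ^ 2 / (8 * θ ^ 2))) * e8 y := by positivity
    have := mul_le_mul_of_nonneg_right h7 hg.le
    linarith
  · push Not at hy
    have h1 : A ^ 2 ≤ C0 ^ 2 := by rw [← sq_abs A]; gcongr; exact hC0 z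
    have h2 : e8 y ≤ Real.exp (-(R ^ 2 / (8 * θ ^ 2))) := by
      rw [e8, Real.exp_le_exp, neg_div, neg_le_neg_iff]
      have h3 : R ≤ θ * ‖y‖ := by
        simpa [hz, norm_smul, abs_of_pos hθ] using hy
      have h4 : R ^ 2 ≤ θ ^ 2 * ∑ i, y i ^ 2 := by
        calc R ^ 2 ≤ (θ * ‖y‖) ^ 2 := by gcongr
          _ = θ ^ 2 * ‖y‖ ^ 2 := by ring
          _ ≤ _ := by gcongr; exact norm_sq_le_sum y
      rw [div_le_div_iff₀ (by positivity) (by norm_num)]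
      nlinarith
    have h5 : (0:ℝ) ≤ 4 * M ^ 2 * (d + 1) * θ ^ 2 * (U z ^ 2 * gam y + (∑ i, (θ * dd (some i) U z) ^ 2) * gam y) := by
      have : 0 ≤ ∑ i, (θ * dd (some i) U z) ^ 2 := Finset.sum_nonneg fun i _ => sq_nonneg _
      positivity
    refine le_trans ?_ (le_add_of_nonneg_left h5)
    rw [gam_eq]
    calc (2 * θ ^ 2 * A) ^ 2 * (e8 y * e8 y) = 4 * θ ^ 4 * A ^ 2 * e8 y * e8 y := by ring
      _ ≤ 4 * θ ^ 4 * C0 ^ 2 * Real.exp (-(R ^ 2 / (8 * θ ^ 2))) * e8 y := by gcongr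

theorem H_lower {U : XT d → ℝ} (sU : Sm U univ) (cU : HasCompactSupport U) {R : ℝ} (hR : 0 < R)
    {x1 : Fin d → ℝ} (hx1 : ‖x1‖ < R / (4 * (d + 1))) (hne : U (x1, 0) ≠ 0) :
    ∃ c > 0, ∃ t1 > 0, ∀ θ, 0 < θ → θ ≤ 1 → θ < t1 →
      c * Real.exp (-(R ^ 2 / (16 * θ ^ 2))) ≤ HH (gg U) θ := by
  have cont := sU.contDiff.continuous
  set c0 := U (x1, 0) ^ 2 / 2 with hc0
  have hc0p : 0 < c0 := by positivity
  have hop : IsOpen {z : XT d | c0 < U z ^ 2} := isOpen_lt continuous_const (cont.pow 2)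
  have hmem : ((x1, 0) : XT d) ∈ {z : XT d | c0 < U z ^ 2} := by
    have : 0 < U (x1, 0) ^ 2 := by positivity
    simp only [mem_ofPred_eq, hc0]; linarith
  obtain ⟨ε, hε, hball⟩ := Metric.isOpen_iff.1 hop _ hmem
  set r0 := min (ε / 2) (R / (4 * (d + 1))) with hr0
  have hr0p : 0 < r0 := by positivity
  refine ⟨c0 * (2 * r0) ^ d, by positivity, min ε 1, by positivity, fun θ hθ hθ1 hθt => ?_⟩
  have hIntg : Integrable (fun y => (gg U (y, θ)) ^ 2 * gam y) := by
    have : LS (fun q : XT d => gg U q ^ 2 * gam q.1) := by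
      have := ((gg_ls cU).mul_right (gg U)).mul_right (fun q => gam q.1)
      convert this using 3
      ring
    exact this.integrable ((((gg_sm sU).contDiff.continuous).pow 2).mul gam_sm.contDiff.continuous) hθ
  set B := Metric.closedBall (θ⁻¹ • x1) r0 with hB
  have hvol : volume.real B = (2 * r0) ^ d := by
    rw [Measure.real, hB, Real.volume_pi_closedBall _ hr0p.le, ENNReal.toReal_ofReal (by positivity)]
    simp
  rw [HH]
  refine le_trans ?_ (setIntegral_le_integral hIntg (s := B)
    (.of_forall fun y => mul_nonneg (sq_nonneg _) (gam_pos y).le))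
  have hle : ∀ y ∈ B, c0 * Real.exp (-(R ^ 2 / (16 * θ ^ 2))) ≤ (gg U (y, θ)) ^ 2 * gam y := by
    intro y hy
    have hy' : ‖y - θ⁻¹ • x1‖ ≤ r0 := by simpa [hB, dist_eq_norm] using hy
    have h1 : ‖θ • y - x1‖ ≤ θ * r0 := by
      have : θ • y - x1 = θ • (y - θ⁻¹ • x1) := by
        rw [smul_sub, smul_smul, mul_inv_cancel₀ hθ.ne', one_smul]
      rw [this, norm_smul, Real.norm_eq_abs, abs_of_pos hθ]; gcongr
    have h2 : θ * r0 ≤ r0 := by nlinarith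
    have h3 : c0 < gg U (y, θ) ^ 2 := by
      refine hball ?_
      rw [Metric.mem_ball, Prod.dist_eq, max_lt_iff]
      refine ⟨?_, ?_⟩
      · rw [dist_eq_norm]
        have : r0 ≤ ε / 2 := min_le_left _ _
        linarith
      · simp only [dist_zero_right, Real.norm_eq_abs, abs_pow, sq_abs]
        have : θ < ε := hθt.trans_le (min_le_left _ _)
        nlinarith
    have h4 : Real.exp (-(R ^ 2 / (16 * θ ^ 2))) ≤ gam y := by
      rw [gam, Real.exp_le_exp, neg_div, neg_le_neg_iff]
      have h5 : θ * ‖y‖ ≤ R / (2 * (d + 1)) := by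
        have : ‖θ • y‖ ≤ ‖θ • y - x1‖ + ‖x1‖ := by simpa using norm_add_le (θ • y - x1) x1
        rw [norm_smul, Real.norm_eq_abs, abs_of_pos hθ] at this
        have h6 : r0 ≤ R / (4 * (d + 1)) := min_le_right _ _
        have h7 : R / (2 * (d + 1)) = R / (4 * (d + 1)) + R / (4 * (d + 1)) := by field_simp; norm_num
        linarith
      have h8 : θ ^ 2 * ∑ i, y i ^ 2 ≤ R ^ 2 / 4 := by
        calc θ ^ 2 * ∑ i, y i ^ 2 ≤ θ ^ 2 * (d * ‖y‖ ^ 2) := by gcongr; exact sum_le_norm_sq y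
          _ = d * (θ * ‖y‖) ^ 2 := by ring
          _ ≤ d * (R / (2 * (d + 1))) ^ 2 := by gcongr
          _ = (d / (d + 1) ^ 2) * (R ^ 2 / 4) := by field_simp; norm_num
          _ ≤ 1 * (R ^ 2 / 4) := by
            gcongr
            rw [div_le_one (by positivity)]
            nlinarith [(Nat.cast_nonneg d : (0:ℝ) ≤ d)]
          _ = _ := one_mul _
      rw [div_le_div_iff₀ (by norm_num) (by positivity)]
      nlinarith
    have := Real.exp_pos (-(R ^ 2 / (16 * θ ^ 2)))
    gcongr
  have := setIntegral_mono_on (μ := volume) (s := B)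
    (integrableOn_const (C := c0 * Real.exp (-(R ^ 2 / (16 * θ ^ 2)))) (by
      exact (isCompact_closedBall _ _).measure_lt_top.ne)) hIntg.integrableOn
    Metric.isClosed_closedBall.measurableSet hle
  rw [setIntegral_const, hvol, smul_eq_mul] at this
  linarith

theorem H_upper {U : XT d → ℝ} (sU : Sm U univ) (cU : HasCompactSupport U)
    (h0 : ∀ l, dw l U 0 = 0) (N : ℕ) : ∃ C : ℝ, ∀ θ, 0 < θ → θ ≤ 1 → HH (gg U) θ ≤ C * θ ^ N := by
  obtain ⟨C, hC, hCz⟩ := decay N sU cU h0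
  obtain ⟨C', hC', hCy⟩ := pow_mul_gam (d := d) N
  refine ⟨C ^ 2 * C' * ∫ y : Fin d → ℝ, e8 y, fun θ hθ hθ1 => ?_⟩
  have : C ^ 2 * C' * (∫ y : Fin d → ℝ, e8 y) * θ ^ N = ∫ y : Fin d → ℝ, C ^ 2 * C' * θ ^ N * e8 y := by
    rw [integral_const_mul]; ring
  rw [this, HH]
  refine integral_mono_of_nonneg (.of_forall fun y => mul_nonneg (sq_nonneg _) (gam_pos y).le)
    (e8_int.const_mul _) (.of_forall fun y => ?_)
  have hn : ‖((θ • y, θ ^ 2) : XT d)‖ ≤ θ * (1 + ‖y‖) := by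
    rw [Prod.norm_def, max_le_iff]
    refine ⟨?_, ?_⟩
    · simp only [norm_smul, Real.norm_eq_abs, abs_of_pos hθ]; nlinarith
    · simp only [norm_pow, Real.norm_eq_abs, abs_of_pos hθ]; nlinarith [norm_nonneg y, mul_nonneg hθ.le (norm_nonneg y)]
  have h1 : gg U (y, θ) ^ 2 ≤ (C * (θ * (1 + ‖y‖)) ^ N) ^ 2 := by
    rw [← sq_abs]
    gcongr
    exact (hCz _).trans (by gcongr)
  have h2 : θ ^ N ≤ 1 := pow_le_one₀ hθ.le hθ1
  have hg := gam_pos y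
  have he := e8_pos y
  have hp : 0 < θ ^ N := by positivity
  calc gg U (y, θ) ^ 2 * gam y ≤ (C * (θ * (1 + ‖y‖)) ^ N) ^ 2 * gam y := by gcongr
    _ = C ^ 2 * (θ ^ N * θ ^ N) * (((1 + ‖y‖) ^ N) ^ 2 * gam y) := by rw [mul_pow θ]; ring
    _ ≤ C ^ 2 * (θ ^ N * 1) * (C' * e8 y) := mul_le_mul (by gcongr) (hCy y) (by positivity) (by positivity)
    _ = _ := by ring

theorem suc_global {U : XT d → ℝ} (sU : Sm U univ) (cU : HasCompactSupport U) {R T M : ℝ}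
    (hR : 0 < R) (hT : 0 < T) (hM : 0 ≤ M)
    (hPDE : ∀ z : XT d, ‖z.1‖ < R → 0 < z.2 → z.2 < T →
      |dd none U z + ∑ i, dd (some i) (dd (some i) U) z| ≤ M * (|U z| + ∑ i, |dd (some i) U z|))
    (h0 : ∀ l, dw l U 0 = 0) {x1 : Fin d → ℝ} (hx1 : ‖x1‖ < R / (4 * (d + 1))) :
    U (x1, 0) = 0 := by
  by_contra hne
  obtain ⟨c, hc, t1, ht1, hlow⟩ := H_lower sU cU hR hx1 hne
  obtain ⟨C0, hC0⟩ : ∃ C0 : ℝ, ∀ z : XT d, |dd none U z + ∑ i, dd (some i) (dd (some i) U) z| ≤ C0 := by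
    have h1 : ∀ i, ∃ C : ℝ, ∀ z, |dd (some i) (dd (some i) U) z| ≤ C := fun i =>
      (((sU.dd isOpen_univ _).dd isOpen_univ _).contDiff.continuous).bounded_above_of_compact_support
        (hcs_dd (hcs_dd cU _) _)
    obtain ⟨C2, hC2⟩ := ((sU.dd isOpen_univ none).contDiff.continuous).bounded_above_of_compact_support
        (hcs_dd cU none)
    choose C hC using h1
    exact ⟨C2 + ∑ i, C i, fun z => (abs_add_le _ _).trans (add_le_add (hC2 z)
      ((Finset.abs_sum_le_sum_abs _ _).trans (Finset.sum_le_sum fun i _ => hC i z)))⟩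
  set Γ := ∫ y : Fin d → ℝ, e8 y with hΓ
  have hΓ0 : 0 ≤ Γ := integral_nonneg fun y => (e8_pos y).le
  set K := 4 * M ^ 2 * (d + 1) + 1 with hK
  have hKp : 0 < K := by positivity
  obtain ⟨θ0, hθ0, hθ1, hθt, hθT, hθK, hθc⟩ : ∃ θ0 > 0, θ0 ≤ 1 ∧ θ0 < t1 ∧ θ0 ^ 2 < T ∧
      K * θ0 ^ 2 ≤ 1 / 4 ∧ 4 * θ0 ^ 2 * C0 ^ 2 * Γ ≤ c := by
    have e1 : ∀ᶠ θ : ℝ in nhds 0, θ < 1 ∧ θ < t1 ∧ θ ^ 2 < T ∧ K * θ ^ 2 < 1 / 4 ∧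
        4 * θ ^ 2 * C0 ^ 2 * Γ < c := by
      refine (((continuous_id.tendsto (0:ℝ)).eventually_lt_const (by norm_num)).and
        (((continuous_id.tendsto (0:ℝ)).eventually_lt_const ht1).and
        (((by fun_prop : Continuous fun θ : ℝ => θ ^ 2).tendsto 0 |>.eventually_lt_const (by simpa using hT)).and
        (((by fun_prop : Continuous fun θ : ℝ => K * θ ^ 2).tendsto 0 |>.eventually_lt_const (by norm_num)).and
        ((by fun_prop : Continuous fun θ : ℝ => 4 * θ ^ 2 * C0 ^ 2 * Γ).tendsto 0 |>.eventually_lt_const (by simpa using hc))))))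
    obtain ⟨ε, hε, hb⟩ := Metric.eventually_nhds_iff.1 e1
    have := hb (y := ε / 2) (by rw [dist_zero_right, Real.norm_eq_abs, abs_of_pos (by positivity)]; linarith)
    exact ⟨ε / 2, by positivity, this.1.le, this.2.1, this.2.2.1, this.2.2.2.1.le, this.2.2.2.2.le⟩
  have sg := gg_sm sU
  have lg := gg_ls cU
  have hH0 : ∀ θ, 0 ≤ HH (gg U) θ := fun θ =>
    integral_nonneg fun y => mul_nonneg (sq_nonneg _) (gam_pos y).le
  have hD0 : ∀ θ, 0 ≤ DD (gg U) θ := fun θ =>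
    integral_nonneg fun y => mul_nonneg (Finset.sum_nonneg fun i _ => sq_nonneg _) (gam_pos y).le
  have := ode_lemma (H := HH (gg U)) (D := DD (gg U))
    (H' := fun θ => 2 * ∫ y, gg U (y, θ) * dd none (gg U) (y, θ) * gam y)
    (D' := fun θ => -2 * ∫ y, ou (gg U) (y, θ) * dd none (gg U) (y, θ) * gam y)
    hθ0 hKp hθK (fun θ hθ => HH_deriv sg lg hθ.1) (fun θ hθ => DD_deriv sg lg hθ.1) hH0 hD0
    (by
      intro θ hθ κ
      have h1 := core_ineq sg lg hθ.1 κ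
      have hθ' : θ ^ 2 ≤ θ0 ^ 2 := by have := hθ.1.le; have := hθ.2; gcongr
      have h2 := F_bound sU cU hR hM hPDE hC0 hθ.1 (hθ.2.trans hθ1) (hθ'.trans_lt hθT)
      have h3 := hlow θ hθ.1 (hθ.2.trans hθ1) (hθ.2.trans_lt hθt)
      have h4 : 4 * θ ^ 4 * C0 ^ 2 * Real.exp (-(R ^ 2 / (8 * θ ^ 2))) * Γ ≤ θ ^ 2 * HH (gg U) θ := by
        have e1 : Real.exp (-(R ^ 2 / (8 * θ ^ 2))) = Real.exp (-(R ^ 2 / (16 * θ ^ 2))) * Real.exp (-(R ^ 2 / (16 * θ ^ 2))) := by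
          rw [← Real.exp_add]; congr 1; have := hθ.1.ne'; field_simp; norm_num
        set E := Real.exp (-(R ^ 2 / (16 * θ ^ 2))) with hE
        have hEp : 0 < E := Real.exp_pos _
        have hE1 : E ≤ 1 := Real.exp_le_one_iff.2 (neg_nonpos.2 (by positivity))
        rw [e1]
        calc 4 * θ ^ 4 * C0 ^ 2 * (E * E) * Γ = θ ^ 2 * ((4 * θ ^ 2 * C0 ^ 2 * Γ) * E * E) := by ring
          _ ≤ θ ^ 2 * ((4 * θ0 ^ 2 * C0 ^ 2 * Γ) * E * 1) := by gcongr
          _ ≤ θ ^ 2 * (c * E * 1) := by gcongr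
          _ ≤ θ ^ 2 * HH (gg U) θ := by rw [mul_one]; gcongr
      have h5 : 0 ≤ θ ^ 2 * DD (gg U) θ := mul_nonneg (sq_nonneg _) (hD0 θ)
      simp only [hK]
      simp only [ge_iff_le] at h1
      linarith)
    (fun N => by
      obtain ⟨C, hC⟩ := H_upper sU cU h0 N
      exact ⟨C, fun θ hθ => hC θ hθ.1 (hθ.2.trans hθ1)⟩)
  have h3 := hlow θ0 hθ0 hθ1 hθt
  rw [this] at h3
  have : 0 < c * Real.exp (-(R ^ 2 / (16 * θ0 ^ 2))) := by positivity
  linarith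

end suc3


section suc4
variable {d : ℕ}

/-- Translation and time reversal. -/
def rv (z0 : XT d) (z : XT d) : XT d := (z0.1 + z.1, z0.2 - z.2)

theorem rv_fderiv (z0 z : XT d) : HasFDerivAt (rv z0)
    ((ContinuousLinearMap.fst ℝ (Fin d → ℝ) ℝ).prod (-ContinuousLinearMap.snd ℝ (Fin d → ℝ) ℝ)) z :=
  (hasFDerivAt_fst.const_add z0.1).prodMk (hasFDerivAt_snd.const_sub z0.2)

theorem rv_contDiff (z0 : XT d) : ContDiff ℝ (⊤ : ℕ∞) (rv z0) := by unfold rv; fun_prop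

def sg : Option (Fin d) → ℝ
  | some _ => 1
  | none => -1

theorem rv_dd {f : XT d → ℝ} (z0 z : XT d) (h : DifferentiableAt ℝ f (rv z0 z)) (i : Option (Fin d)) :
    dd i (fun z => f (rv z0 z)) z = sg i * dd i f (rv z0 z) := by
  have := h.hasFDerivAt.comp z (rv_fderiv z0 z)
  have h3 : (fun z => f (rv z0 z)) = f ∘ rv z0 := rfl
  simp only [dd]
  rw [h3, this.fderiv, ContinuousLinearMap.comp_apply]
  rw [← smul_eq_mul, ← map_smul]
  congr 1
  cases i <;> ext <;> simp [bv, sg]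

theorem rv_dw {f : XT d → ℝ} {O : Set (XT d)} (hO : IsOpen O) (hf : Sm f O) (z0 : XT d)
    (l : List (Option (Fin d))) : ∃ c : ℝ, ∀ z, rv z0 z ∈ O →
      dw l (fun z => f (rv z0 z)) z = c * dw l f (rv z0 z) := by
  induction l with
  | nil => exact ⟨1, by simp [dw]⟩
  | cons i l ih =>
    obtain ⟨c, hc⟩ := ih
    refine ⟨c * sg i, fun z hz => ?_⟩
    have hO' : IsOpen (rv z0 ⁻¹' O) := hO.preimage (rv_contDiff z0).continuous
    have h1 : EqOn (dw l (fun z => f (rv z0 z))) (fun z => (fun w => c * dw l f w) (rv z0 z)) (rv z0 ⁻¹' O) :=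
      fun z hz => hc z hz
    have hd := (hf.dw hO l).diffAt hO hz
    rw [dw, dd_congr hO' h1 i hz, rv_dd z0 z (hd.const_mul c) i, dw]
    simp only [dd]
    rw [fderiv_const_mul hd, _root_.smul_apply, smul_eq_mul]
    ring

theorem suc_local {f a : XT d → ℝ} {b : Fin d → XT d → ℝ} {O : Set (XT d)} (hO : IsOpen O)
    (hf : Sm f O) (ha : Sm a O) (hb : ∀ i, Sm (b i) O) (h : PDE f a b O)
    {z0 : XT d} (hz0 : z0 ∈ O) (hvan : ∀ l, dw l f z0 = 0) :
    ∃ δ > 0, ∀ x, ‖x - z0.1‖ < δ → f (x, z0.2) = 0 := by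
  set O' := rv z0 ⁻¹' O with hO'd
  have hO' : IsOpen O' := hO.preimage (rv_contDiff z0).continuous
  have h00 : rv z0 0 = z0 := by simp [rv]
  have h0' : (0 : XT d) ∈ O' := by simpa [hO'd, h00] using hz0
  obtain ⟨ρ', hρ', hball⟩ := Metric.nhds_basis_closedBall.mem_iff.1 (hO'.mem_nhds h0')
  set ρ := ρ' / 2 with hρd
  have hρ : 0 < ρ := by positivity
  let χ : ContDiffBump (0 : XT d) := ⟨ρ, ρ', hρ, by simp only [hρd]; linarith⟩
  set u : XT d → ℝ := fun z => f (rv z0 z) with hu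
  have su : Sm u O' := hf.comp (rv_contDiff z0).contDiffOn (fun z hz => hz)
  set U : XT d → ℝ := fun z => χ z * u z with hU
  have sU : Sm U univ := by
    refine (contDiff_iff_contDiffAt.2 fun z => ?_).contDiffOn
    by_cases hz : z ∈ O'
    · exact (χ.contDiff.contDiffAt).mul (su.contDiffAt (hO'.mem_nhds hz))
    · have hz' : z ∉ Metric.closedBall (0 : XT d) ρ' := fun h => hz (hball h)
      have hop : IsOpen (Metric.closedBall (0 : XT d) ρ')ᶜ := Metric.isClosed_closedBall.isOpen_compl
      have : U =ᶠ[nhds z] fun _ => 0 := by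
        filter_upwards [hop.mem_nhds hz'] with w hw
        have : χ w = 0 := χ.zero_of_le_dist (by
          simp only [mem_compl_iff, Metric.mem_closedBall, not_le] at hw
          exact hw.le)
        simp [hU, this]
      exact contDiffAt_const.congr_of_eventuallyEq this
  have cU : HasCompactSupport U := χ.hasCompactSupport.mul_right
  have hEq : EqOn U u (Metric.ball 0 ρ) := fun z hz => by
    have : χ z = 1 := χ.one_of_mem_closedBall (Metric.ball_subset_closedBall hz)
    simp [hU, this]
  have hsub : Metric.ball (0 : XT d) ρ ⊆ O' := fun z hz => hball
    (Metric.closedBall_subset_closedBall (by simp only [hρd]; linarith) (Metric.ball_subset_closedBall hz))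
  have hsub' : Metric.closedBall (0 : XT d) ρ ⊆ O' := fun z hz => hball
    (Metric.closedBall_subset_closedBall (by simp only [hρd]; linarith) hz)
  have hwords : ∀ l, dw l U 0 = 0 := by
    intro l
    rw [dw_congr Metric.isOpen_ball hEq l (by simpa using hρ)]
    obtain ⟨c, hc⟩ := rv_dw hO hf z0 l
    rw [hc 0 h0', h00, hvan, mul_zero]
  obtain ⟨Ma, hMa⟩ := (isCompact_closedBall (0 : XT d) ρ).exists_bound_of_continuousOn
    (f := fun z => a (rv z0 z))
    ((ha.comp (rv_contDiff z0).contDiffOn (fun z hz => hz)).continuousOn.mono hsub')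
  have : ∀ i, ∃ C, ∀ z ∈ Metric.closedBall (0 : XT d) ρ, ‖b i (rv z0 z)‖ ≤ C := fun i =>
    (isCompact_closedBall (0 : XT d) ρ).exists_bound_of_continuousOn
    (f := fun z => b i (rv z0 z))
    (((hb i).comp (rv_contDiff z0).contDiffOn (fun z hz => hz)).continuousOn.mono hsub')
  choose Mb hMb using this
  have h0b : (0 : XT d) ∈ Metric.closedBall (0 : XT d) ρ := by simpa using hρ.le
  have hMa0 : 0 ≤ Ma := (norm_nonneg _).trans (hMa 0 h0b)
  have hMb0 : ∀ i, 0 ≤ Mb i := fun i => (norm_nonneg _).trans (hMb i 0 h0b)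
  set M := Ma + ∑ i, Mb i with hM
  have hM1 : Ma ≤ M := by have := Finset.sum_nonneg fun i (_ : i ∈ Finset.univ) => hMb0 i; linarith
  have hM2 : ∀ i, Mb i ≤ M := fun i => by
    have := Finset.single_le_sum (f := Mb) (fun i _ => hMb0 i) (Finset.mem_univ i); linarith
  have hP : ∀ z : XT d, ‖z.1‖ < ρ → 0 < z.2 → z.2 < ρ →
      |dd none U z + ∑ i, dd (some i) (dd (some i) U) z| ≤ M * (|U z| + ∑ i, |dd (some i) U z|) := by
    intro z h1 h2 h3
    have hz : z ∈ Metric.ball (0 : XT d) ρ := by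
      rw [mem_ball_zero_iff, Prod.norm_def, max_lt_iff]
      exact ⟨h1, by rw [Real.norm_eq_abs, abs_of_pos h2]; exact h3⟩
    have hzc := Metric.ball_subset_closedBall hz
    have hzO : rv z0 z ∈ O := hsub hz
    have e1 : ∀ i, dd i U z = sg i * dd i f (rv z0 z) := fun i => by
      rw [dd_congr Metric.isOpen_ball hEq i hz, rv_dd z0 z (hf.diffAt hO hzO) i]
    have e2 : ∀ i : Fin d, dd (some i) (dd (some i) U) z = dd (some i) (dd (some i) f) (rv z0 z) := fun i => by
      rw [dd_congr Metric.isOpen_ball (dd_congr Metric.isOpen_ball hEq (some i)) (some i) hz]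
      have : EqOn (dd (some i) u) (fun z => dd (some i) f (rv z0 z)) O' := fun w hw => by
        rw [hu, rv_dd z0 w (hf.diffAt hO hw) (some i)]; simp [sg]
      rw [dd_congr hO' this (some i) (hsub hz), rv_dd z0 z ((hf.dd hO _).diffAt hO hzO)]
      simp [sg]
    have e3 : U z = f (rv z0 z) := hEq hz
    simp only [e2]
    rw [e1 none]
    simp only [e1, e3]
    simp only [sg, one_mul]
    rw [h _ hzO]
    have : -1 * (∑ i, dd (some i) (dd (some i) f) (rv z0 z) + a (rv z0 z) * f (rv z0 z) +
        ∑ i, b i (rv z0 z) * dd (some i) f (rv z0 z)) + ∑ i, dd (some i) (dd (some i) f) (rv z0 z)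
        = -(a (rv z0 z) * f (rv z0 z) + ∑ i, b i (rv z0 z) * dd (some i) f (rv z0 z)) := by ring
    rw [this, abs_neg]
    refine (abs_add_le _ _).trans ?_
    rw [mul_add, Finset.mul_sum]
    refine add_le_add ?_ ((Finset.abs_sum_le_sum_abs _ _).trans (Finset.sum_le_sum fun i _ => ?_))
    · rw [abs_mul]; gcongr; exact (hMa z hzc).trans hM1
    · rw [abs_mul]; gcongr; exact (hMb i z hzc).trans (hM2 i)
  refine ⟨min ρ (ρ / (4 * (d + 1))), by positivity, fun x hx => ?_⟩
  have h1 := suc_global sU cU hρ hρ (hMa0.trans hM1) hP hwords (x1 := x - z0.1) (hx.trans_le (min_le_right _ _))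
  have h2 : ((x - z0.1, 0) : XT d) ∈ Metric.ball (0 : XT d) ρ := by
    rw [mem_ball_zero_iff, Prod.norm_def, max_lt_iff]
    exact ⟨hx.trans_le (min_le_left _ _), by simpa using hρ⟩
  rw [hEq h2] at h1
  simpa [hu, rv] using h1

theorem exists_word {f a : XT d → ℝ} {b : Fin d → XT d → ℝ} {Ω : Set (Fin d → ℝ)} {I : Set ℝ}
    (hΩ : IsOpen Ω) (hΩc : IsConnected Ω) (hI : IsOpen I)
    (hf : Sm f (Ω ×ˢ I)) (ha : Sm a (Ω ×ˢ I)) (hb : ∀ i, Sm (b i) (Ω ×ˢ I)) (h : PDE f a b (Ω ×ˢ I))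
    {t0 : ℝ} (ht0 : t0 ∈ I) (hnt : ∃ x ∈ Ω, f (x, t0) ≠ 0) {x0 : Fin d → ℝ} (hx0 : x0 ∈ Ω) :
    ∃ l, dw l f (x0, t0) ≠ 0 := by
  by_contra hcon
  push Not at hcon
  have hO := hΩ.prod hI
  set A := {x | x ∈ Ω ∧ ∀ l, dw l f (x, t0) = 0} with hA
  set B := {x | x ∈ Ω ∧ ∃ l, dw l f (x, t0) ≠ 0} with hB
  have oA : IsOpen A := by
    rw [isOpen_iff_mem_nhds]
    rintro x ⟨hx, hl⟩
    obtain ⟨δ, hδ, hz⟩ := suc_local hO hf ha hb h (z0 := (x, t0)) ⟨hx, ht0⟩ hl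
    have hU : IsOpen (Ω ∩ Metric.ball x δ) := hΩ.inter Metric.isOpen_ball
    refine Filter.mem_of_superset (hU.mem_nhds ⟨hx, by simpa using hδ⟩) ?_
    rintro y ⟨hy, hyb⟩
    refine ⟨hy, fun l => ?_⟩
    refine slice_van hO hf ha hb h hU (t0 := t0) ?_ ?_ (l.length + 1) l (by simp) (y, t0) ⟨⟨hy, hyb⟩, rfl⟩
    · rintro ⟨p, q⟩ ⟨⟨hp, _⟩, hq⟩
      exact ⟨hp, by rw [show q = t0 from hq]; exact ht0⟩
    · rintro w ⟨_, hw⟩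
      exact hz w (by simpa [dist_eq_norm] using hw)
  have oB : IsOpen B := by
    have : B = ⋃ l, {x | x ∈ Ω ∧ dw l f (x, t0) ≠ 0} := by
      ext x; simp [hB]
    rw [this]
    refine isOpen_iUnion fun l => ?_
    have hc : ContinuousOn (fun x => dw l f (x, t0)) Ω :=
      (hf.dw hO l).continuousOn.comp (by fun_prop) (fun x hx => ⟨hx, ht0⟩)
    exact hc.isOpen_inter_preimage hΩ (isOpen_compl_singleton (x := (0:ℝ)))
  obtain ⟨x1, hx1, hne⟩ := hnt
  obtain ⟨y, -, hyA, hyB⟩ := hΩc.isPreconnected A B oA oB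
    (fun x hx => by
      by_cases hc : ∀ l, dw l f (x, t0) = 0
      · exact Or.inl ⟨hx, hc⟩
      · push Not at hc; exact Or.inr ⟨hx, hc⟩)
    ⟨x0, hx0, hx0, hcon⟩ ⟨x1, hx1, hx1, [], hne⟩
  obtain ⟨l, hl⟩ := hyB.2
  exact hl (hyA.2 l)

end suc4


section interp
variable {d : ℕ}

theorem exists_weights (m : ℕ) : ∃ w : Fin (m + 1) → ℝ, ∀ k : ℕ, k ≤ m →
    ∑ j, w j * (j : ℝ) ^ k = if k = 1 then 1 else 0 := by
  set V := Matrix.vandermonde (fun j : Fin (m + 1) => (j : ℝ)) with hV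
  have hdet : IsUnit V.transpose := by
    rw [Matrix.isUnit_iff_isUnit_det, Matrix.det_transpose, isUnit_iff_ne_zero]
    exact Matrix.det_vandermonde_ne_zero_iff.2 fun a b h => Fin.ext (by simpa using h)
  obtain ⟨w, hw⟩ := Matrix.mulVec_surjective_iff_isUnit.2 hdet
    (fun k : Fin (m + 1) => if (k : ℕ) = 1 then (1:ℝ) else 0)
  refine ⟨w, fun k hk => ?_⟩
  have := congrFun hw ⟨k, by omega⟩
  simp only [Matrix.mulVec, dotProduct, Matrix.transpose_apply, hV, Matrix.vandermonde_apply] at this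
  rw [← this]
  exact Finset.sum_congr rfl fun j _ => mul_comm _ _

theorem line_iter {O : Set (XT d)} (hO : IsOpen O) {g : XT d → ℝ} (sg : Sm g O) (z : XT d)
    (i : Option (Fin d)) (k : ℕ) : ∀ s : ℝ, z + s • bv i ∈ O →
      iteratedDeriv k (fun s : ℝ => g (z + s • bv i)) s = dw (List.replicate k i) g (z + s • bv i) := by
  induction k with
  | zero => intro s _; simp [dw]
  | succ k ih =>
    intro s hs
    have hV : IsOpen {s : ℝ | z + s • bv i ∈ O} := hO.preimage (by fun_prop)
    have he : iteratedDeriv k (fun s : ℝ => g (z + s • bv i)) =ᶠ[nhds s]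
        fun s => dw (List.replicate k i) g (z + s • bv i) := by
      filter_upwards [hV.mem_nhds hs] with w hw using ih w hw
    rw [iteratedDeriv_succ, he.deriv_eq, List.replicate_succ, dw]
    have h1 : HasDerivAt (fun s : ℝ => z + s • (bv i : XT d)) (bv i) s := by
      simpa using ((hasDerivAt_id s).smul_const (bv i : XT d)).const_add z
    exact (((sg.dw hO _).diffAt hO hs).hasFDerivAt.comp_hasDerivAt s h1).deriv

theorem one_step (m : ℕ) (hm : 1 ≤ m) : ∃ c : ℝ, 0 ≤ c ∧ ∀ (g : XT d → ℝ) (O : Set (XT d)),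
    IsOpen O → Sm g O → ∀ (z : XT d) (i : Option (Fin d)) (h A B : ℝ), 0 < h →
    (∀ s ∈ Icc 0 (m * h), z + s • bv i ∈ O ∧ |g (z + s • bv i)| ≤ A ∧
      |dw (List.replicate (m + 1) i) g (z + s • bv i)| ≤ B) →
    |dd i g z| ≤ c * (A / h + B * h ^ m) := by
  obtain ⟨w, hw⟩ := exists_weights m
  refine ⟨(∑ j, |w j|) * (1 + (m : ℝ) ^ (m + 1)), by positivity, ?_⟩
  intro g O hO sg z i h A B hh hyp
  set G : ℝ → ℝ := fun s => g (z + s • bv i) with hG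
  have hmh : 0 < m * h := by positivity
  have hcd : ∀ s ∈ Icc 0 (m * h), ContDiffAt ℝ (⊤ : ℕ∞) G s := fun s hs =>
    (sg.contDiffAt (hO.mem_nhds (hyp s hs).1)).comp s (by fun_prop)
  have hu : UniqueDiffOn ℝ (Icc 0 (m * h)) := uniqueDiffOn_Icc hmh
  have hle : ∀ k : ℕ, ((k : ℕ) : WithTop ℕ∞) ≤ ((⊤ : ℕ∞) : WithTop ℕ∞) := fun k => by
    exact_mod_cast (le_top : (k : ℕ∞) ≤ ⊤)
  have hit : ∀ k : ℕ, ∀ s ∈ Icc 0 (m * h), iteratedDerivWithin k G (Icc 0 (m * h)) s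
      = dw (List.replicate k i) g (z + s • bv i) := fun k s hs => by
    rw [iteratedDerivWithin_eq_iteratedDeriv hu ((hcd s hs).of_le (hle k)) hs]
    exact line_iter hO sg z i k s (hyp s hs).1
  have hB0 : 0 ≤ B := (abs_nonneg _).trans (hyp 0 ⟨le_rfl, hmh.le⟩).2.2
  have hA0 : 0 ≤ A := (abs_nonneg _).trans (hyp 0 ⟨le_rfl, hmh.le⟩).2.1
  have hmem : ∀ j : Fin (m + 1), (j : ℝ) * h ∈ Icc 0 (m * h) := fun j =>
    ⟨by positivity, by gcongr; exact_mod_cast Nat.lt_succ_iff.1 j.2⟩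
  have htay : ∀ j : Fin (m + 1), |taylorWithinEval G m (Icc 0 (m * h)) 0 (j * h)| ≤
      A + B * ((m : ℝ) ^ (m + 1) * h ^ (m + 1)) := by
    intro j
    have h1 := taylor_mean_remainder_bound (f := G) (a := 0) (b := m * h) (C := B) (n := m) (x := j * h)
      hmh.le (fun s hs => ((hcd s hs).of_le (by exact_mod_cast hle (m + 1))).contDiffWithinAt) (hmem j)
      (fun s hs => by rw [hit _ s hs]; exact (hyp s hs).2.2)
    have h2 : B * ((j : ℝ) * h - 0) ^ (m + 1) / m.factorial ≤ B * ((m : ℝ) ^ (m + 1) * h ^ (m + 1)) := by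
      rw [sub_zero, ← mul_pow]
      refine (div_le_self (by positivity) (by exact_mod_cast Nat.one_le_iff_ne_zero.2 m.factorial_ne_zero)).trans ?_
      gcongr
      exact_mod_cast Nat.lt_succ_iff.1 j.2
    have h3 := (hyp _ (hmem j)).2.1
    have h4 : |taylorWithinEval G m (Icc 0 (m * h)) 0 (j * h)| ≤ |G (j * h)| +
      ‖G (j * h) - taylorWithinEval G m (Icc 0 (m * h)) 0 (j * h)‖ := by
      rw [Real.norm_eq_abs]
      have := abs_sub (G (j * h)) (G (j * h) - taylorWithinEval G m (Icc 0 (m * h)) 0 (j * h))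
      simpa using this
    exact h4.trans (add_le_add h3 (h1.trans h2))
  have hsum : ∑ j, w j * taylorWithinEval G m (Icc 0 (m * h)) 0 (j * h) = h * dd i g z := by
    simp only [taylor_within_apply, sub_zero, smul_eq_mul, Finset.mul_sum]
    rw [Finset.sum_comm]
    have : ∀ k ∈ Finset.range (m + 1), ∑ j : Fin (m + 1), w j * ((k.factorial : ℝ)⁻¹ * ((j : ℝ) * h) ^ k *
        iteratedDerivWithin k G (Icc 0 (m * h)) 0) = if k = 1 then h * dd i g z else 0 := by
      intro k hk
      have e : ∀ j : Fin (m + 1), w j * ((k.factorial : ℝ)⁻¹ * ((j : ℝ) * h) ^ k *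
        iteratedDerivWithin k G (Icc 0 (m * h)) 0) = (w j * (j : ℝ) ^ k) *
          ((k.factorial : ℝ)⁻¹ * h ^ k * iteratedDerivWithin k G (Icc 0 (m * h)) 0) := fun j => by
        rw [mul_pow]; ring
      simp only [e, ← Finset.sum_mul]
      rw [hw k (by simpa [Nat.lt_succ_iff] using hk)]
      split_ifs with h1
      · subst h1
        rw [hit 1 0 ⟨le_rfl, hmh.le⟩]
        simp [dw]
      · simp
    rw [Finset.sum_congr rfl this]
    simp; omega
  have hfin : h * |dd i g z| ≤ (∑ j, |w j|) * (A + B * ((m : ℝ) ^ (m + 1) * h ^ (m + 1))) := by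
    rw [← abs_of_pos hh, ← abs_mul, abs_of_pos hh, ← hsum, Finset.sum_mul]
    refine (Finset.abs_sum_le_sum_abs _ _).trans (Finset.sum_le_sum fun j _ => ?_)
    rw [abs_mul]; gcongr; exact htay j
  have : |dd i g z| ≤ (∑ j, |w j|) * (A + B * ((m : ℝ) ^ (m + 1) * h ^ (m + 1))) / h := by
    rw [le_div_iff₀ hh]; linarith
  refine this.trans ?_
  have e : (∑ j, |w j|) * (A + B * ((m : ℝ) ^ (m + 1) * h ^ (m + 1))) / h
    = (∑ j, |w j|) * (A / h + (m : ℝ) ^ (m + 1) * (B * h ^ m)) := by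
    field_simp
    ring
  rw [e, mul_assoc]
  gcongr
  have h1 : 0 ≤ A / h := by positivity
  have h2 : 0 ≤ B * h ^ m := by positivity
  have h3 : (0:ℝ) ≤ (m : ℝ) ^ (m + 1) := by positivity
  nlinarith

end interp


section interp2
variable {d : ℕ}

theorem dw_append (l l' : List (Option (Fin d))) (f : XT d → ℝ) : dw (l ++ l') f = dw l (dw l' f) := by
  induction l with
  | nil => rfl
  | cons i l ih => simp only [List.cons_append, dw, ih]

theorem dw_sub {f g : XT d → ℝ} {O : Set (XT d)} (hO : IsOpen O) (hf : Sm f O) (hg : Sm g O)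
    (l : List (Option (Fin d))) :
    EqOn (dw l (fun z => f z - g z)) (fun z => dw l f z - dw l g z) O := by
  induction l with
  | nil => intro z _; rfl
  | cons i l ih =>
    intro z hz
    have h1 := dd_congr hO ih i hz
    simp only [dw]
    rw [h1]
    simp only [dd]
    rw [fderiv_fun_sub ((hf.dw hO l).diffAt hO hz) ((hg.dw hO l).diffAt hO hz)]
    rfl

theorem bv_norm (i : Option (Fin d)) : ‖(bv i : XT d)‖ ≤ 1 := by
  cases i with
  | none => simp [bv, Prod.norm_def]
  | some i =>
    rw [bv, Prod.norm_def, max_le_iff]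
    refine ⟨?_, by simp⟩
    refine (pi_norm_le_iff_of_nonneg zero_le_one).2 fun j => ?_
    by_cases h : j = i
    · subst h; simp
    · simp [h]

theorem word_holder {O : Set (XT d)} (hO : IsOpen O) {f : ℝ → XT d → ℝ} {T : Set ℝ}
    (sf : ∀ τ ∈ T, Sm (f τ) O) {z0 : XT d} {ρ η : ℝ} {m N : ℕ} (hm : 1 ≤ m)
    (hmη : 1 ≤ η * m) (hη : 0 < η) {B L : ℝ} (hB0 : 0 ≤ B) (hL0 : 0 ≤ L)
    (hρ : Metric.closedBall z0 ρ ⊆ O)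
    (hB : ∀ τ ∈ T, ∀ l : List (Option (Fin d)), l.length ≤ N → ∀ z ∈ Metric.closedBall z0 ρ, |dw l (f τ) z| ≤ B)
    (hT : ∀ τ ∈ T, ∀ τ' ∈ T, |τ - τ'| ≤ 1)
    (hL : ∀ τ ∈ T, ∀ τ' ∈ T, ∀ z ∈ Metric.closedBall z0 ρ, |f τ z - f τ' z| ≤ L * |τ - τ'|)
    (l : List (Option (Fin d))) : l.length + m ≤ N → ∀ ρ' < ρ, ∃ C : ℝ, 0 ≤ C ∧ ∀ τ ∈ T, ∀ τ' ∈ T,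
      ∀ z ∈ Metric.closedBall z0 ρ',
      |dw l (f τ) z - dw l (f τ') z| ≤ C * |τ - τ'| ^ (1 - l.length * η) := by
  induction l with
  | nil =>
    intro _ ρ' hρ'
    refine ⟨L, hL0, fun τ hτ τ' hτ' z hz => ?_⟩
    simpa [dw] using hL τ hτ τ' hτ' z (Metric.closedBall_subset_closedBall hρ'.le hz)
  | cons i l ih =>
    intro hN ρ' hρ'
    simp only [List.length_cons] at hN ⊢
    obtain ⟨C, hC0, hC⟩ := ih (by omega) ((ρ' + ρ) / 2) (by linarith)
    obtain ⟨c, hc0, hc⟩ := one_step (d := d) m hm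
    have hmp : (0:ℝ) < m := by exact_mod_cast hm
    set κ := ((ρ' + ρ) / 2 - ρ') / m with hκ
    have hκp : 0 < κ := div_pos (by linarith) hmp
    refine ⟨c * (C / κ + 2 * B * κ ^ m), by positivity, fun τ hτ τ' hτ' z hz => ?_⟩
    by_cases hΔ : τ = τ'
    · subst hΔ; simp only [sub_self, abs_zero]; positivity
    set Δ := |τ - τ'| with hΔd
    have hΔp : 0 < Δ := abs_pos.2 (sub_ne_zero.2 hΔ)
    have hΔ1 : Δ ≤ 1 := hT τ hτ τ' hτ'
    have hη1 : Δ ^ η ≤ 1 := Real.rpow_le_one hΔp.le hΔ1 hη.le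
    have hηp : 0 < Δ ^ η := Real.rpow_pos_of_pos hΔp _
    have s1 := (sf τ hτ).dw hO l
    have s2 := (sf τ' hτ').dw hO l
    have hzO : z ∈ O := hρ (Metric.closedBall_subset_closedBall hρ'.le hz)
    have key := hc (fun z => dw l (f τ) z - dw l (f τ') z) O hO (s1.sub s2) z i (κ * Δ ^ η)
      (C * Δ ^ (1 - l.length * η)) (2 * B) (by positivity) (by
        intro s hs
        have hin : z + s • bv i ∈ Metric.closedBall z0 ((ρ' + ρ) / 2) := by
          rw [Metric.mem_closedBall, dist_eq_norm] at hz ⊢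
          have e1 : z + s • bv i - z0 = (z - z0) + s • bv i := by abel
          rw [e1]
          have e2 : ‖s • (bv i : XT d)‖ ≤ m * κ := by
            rw [norm_smul, Real.norm_eq_abs, abs_of_nonneg hs.1]
            calc s * ‖(bv i : XT d)‖ ≤ s * 1 := by have := hs.1; gcongr; exact bv_norm i
              _ ≤ m * (κ * Δ ^ η) := by rw [mul_one]; exact hs.2
              _ ≤ m * (κ * 1) := by gcongr
              _ = _ := by ring
          have e3 : m * κ = (ρ' + ρ) / 2 - ρ' := by rw [hκ]; field_simp
          have := norm_add_le (z - z0) (s • (bv i : XT d))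
          linarith
        have hin' := Metric.closedBall_subset_closedBall (by linarith : (ρ' + ρ) / 2 ≤ ρ) hin
        refine ⟨hρ hin', hC τ hτ τ' hτ' _ hin, ?_⟩
        rw [dw_sub hO s1 s2 _ (hρ hin')]
        simp only [← dw_append]
        have hlen : (List.replicate (m + 1) i ++ l).length ≤ N := by simp; omega
        have b1 := hB τ hτ _ hlen _ hin'
        have b2 := hB τ' hτ' _ hlen _ hin'
        have := abs_sub (dw (List.replicate (m + 1) i ++ l) (f τ) (z + s • bv i))
          (dw (List.replicate (m + 1) i ++ l) (f τ') (z + s • bv i))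
        linarith)
    have hsub := dw_sub hO s1 s2 [i] hzO
    simp only [dw] at hsub
    rw [hsub] at key
    simp only [dw]
    refine key.trans ?_
    rw [mul_assoc c]
    gcongr
    rw [add_mul]
    refine add_le_add (le_of_eq ?_) ?_
    · have : (1 - ((l.length + 1 : ℕ) : ℝ) * η) = (1 - l.length * η) - η := by push_cast; ring
      rw [this, Real.rpow_sub hΔp (1 - l.length * η) η, mul_div_mul_comm]
    · rw [mul_pow, ← Real.rpow_natCast (Δ ^ η), ← Real.rpow_mul hΔp.le, ← mul_assoc]
      gcongr ?_ * ?_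
      refine Real.rpow_le_rpow_of_exponent_ge hΔp hΔ1 ?_
      have : 0 ≤ ((l.length + 1 : ℕ) : ℝ) * η := by positivity
      linarith

end interp2


section geo
variable {d : ℕ}

theorem lin_est {O : Set (XT d)} (hO : IsOpen O) {w : ℝ → XT d → ℝ} {T : Set ℝ}
    (sw : ∀ τ ∈ T, Sm (w τ) O) {Bl : Set (XT d)} (hBo : IsOpen Bl) (hBO : Bl ⊆ O) {C s : ℝ} (hs : 0 < s)
    (hC : ∀ τ ∈ T, ∀ τ' ∈ T, ∀ z ∈ Bl, |w τ z - w τ' z| ≤ C * |τ - τ'| ^ s)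
    (hCd : ∀ i, ∀ τ ∈ T, ∀ τ' ∈ T, ∀ z ∈ Bl, |dd i (w τ) z - dd i (w τ') z| ≤ C * |τ - τ'| ^ s)
    {z1 : XT d} {τ1 : ℝ} (hz1 : z1 ∈ Bl) (hτ1 : τ1 ∈ T) {ε : ℝ} (hε : 0 < ε) :
    ∃ V ∈ nhds (z1, τ1), ∀ q ∈ V, ∀ q' ∈ V, q.2 ∈ T → q'.2 ∈ T → w q.2 q.1 = 0 → w q'.2 q'.1 = 0 →
      |fderiv ℝ (w τ1) z1 (q.1 - q'.1)| ≤ ε * ‖q.1 - q'.1‖ + C * |q.2 - q'.2| ^ s := by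
  have hcont : ContinuousAt (fderiv ℝ (w τ1)) z1 :=
    (((sw τ1 hτ1).fderiv_of_isOpen (m := (⊤ : ℕ∞)) hO (by simp)).continuousOn).continuousAt
      (hO.mem_nhds (hBO hz1))
  have h1 : ∀ᶠ ζ in nhds z1, ‖fderiv ℝ (w τ1) ζ - fderiv ℝ (w τ1) z1‖ < ε / 2 := by
    have := Metric.tendsto_nhds.1 hcont (ε / 2) (by positivity)
    simpa [dist_eq_norm] using this
  obtain ⟨δ, hδ, hball⟩ := Metric.mem_nhds_iff.1 (Filter.inter_mem h1 (hBo.mem_nhds hz1))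
  have h2 : ∀ᶠ τ in nhds τ1, (∑ _i : Option (Fin d), C * |τ - τ1| ^ s) < ε / 2 := by
    have hc : ContinuousAt (fun τ : ℝ => ∑ _i : Option (Fin d), C * |τ - τ1| ^ s) τ1 := by
      refine tendsto_finsetSum _ fun i _ => ?_
      refine ContinuousAt.mul continuousAt_const (ContinuousAt.rpow_const (by fun_prop) (Or.inr hs.le))
    refine hc.eventually_lt_const ?_
    simp [Real.zero_rpow hs.ne']; exact hε
  refine ⟨Metric.ball z1 δ ×ˢ {τ | (∑ _i : Option (Fin d), C * |τ - τ1| ^ s) < ε / 2},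
    prod_mem_nhds (Metric.ball_mem_nhds _ hδ) h2, ?_⟩
  rintro ⟨z, τ⟩ ⟨hz, hτ⟩ ⟨z', τ'⟩ ⟨hz', hτ'⟩ hT hT' hw hw'
  simp only at *
  have hder : ∀ ζ ∈ Metric.ball z1 δ, ‖fderiv ℝ (w τ) ζ - fderiv ℝ (w τ1) z1‖ ≤ ε := by
    intro ζ hζ
    have hζB : ζ ∈ Bl := (hball hζ).2
    have hζO := hBO hζB
    have e1 : ‖fderiv ℝ (w τ) ζ - fderiv ℝ (w τ1) ζ‖ ≤ ε / 2 := by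
      rw [← fderiv_fun_sub ((sw τ hT).diffAt hO hζO) ((sw τ1 hτ1).diffAt hO hζO)]
      refine (fderiv_norm_le _ _).trans ((Finset.sum_le_sum fun i _ => ?_).trans hτ.le)
      have := dw_sub hO (sw τ hT) (sw τ1 hτ1) [i] hζO
      simp only [dw] at this
      rw [this]
      exact hCd i τ hT τ1 hτ1 ζ hζB
    have e2 : ‖fderiv ℝ (w τ1) ζ - fderiv ℝ (w τ1) z1‖ < ε / 2 := (hball hζ).1
    have := norm_add_le (fderiv ℝ (w τ) ζ - fderiv ℝ (w τ1) ζ) (fderiv ℝ (w τ1) ζ - fderiv ℝ (w τ1) z1)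
    rw [sub_add_sub_cancel] at this
    linarith
  have h3 := (convex_ball z1 δ).norm_image_sub_le_of_norm_fderiv_le' (𝕜 := ℝ) (f := w τ)
    (fun ζ hζ => (sw τ hT).diffAt hO (hBO (hball hζ).2)) hder hz' hz
  have h4 := hC τ hT τ' hT' z' (hball hz').2
  rw [hw', sub_zero] at h4
  rw [hw, Real.norm_eq_abs] at h3
  have h5 : |fderiv ℝ (w τ1) z1 (z - z')| ≤ |0 - w τ z' - fderiv ℝ (w τ1) z1 (z - z')| + |w τ z'| := by
    have := abs_add_le (0 - w τ z' - fderiv ℝ (w τ1) z1 (z - z')) (w τ z')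
    rw [show 0 - w τ z' - fderiv ℝ (w τ1) z1 (z - z') + w τ z' = - fderiv ℝ (w τ1) z1 (z - z') by ring, abs_neg] at this
    exact this
  linarith

/-- Coordinates on space-time. -/
def co (k : Option (Fin d)) : XT d →ₗ[ℝ] ℝ :=
  match k with
  | some i => (LinearMap.proj i).comp (LinearMap.fst ℝ (Fin d → ℝ) ℝ)
  | none => LinearMap.snd ℝ (Fin d → ℝ) ℝ

theorem clm_co (L : XT d →L[ℝ] ℝ) (z : XT d) : L z = ∑ k, co k z * L (bv k) := by
  rw [clm_basis, Fintype.sum_option]; rfl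

theorem co_ext {z : XT d} (h : ∀ k, co k z = 0) : z = 0 := by
  ext i
  · exact h (some i)
  · exact h none

abbrev Kij (i j : Option (Fin d)) := {k : Option (Fin d) // k ≠ i ∧ k ≠ j}

def pr (i j : Option (Fin d)) : XT d →ₗ[ℝ] (Kij i j → ℝ) := LinearMap.pi fun k => co k.1

theorem Kij_card {i j : Option (Fin d)} (h : i ≠ j) : Fintype.card (Kij i j) + 1 = d := by
  have h1 : Fintype.card (Kij i j) = (Finset.univ \ ({i, j} : Finset (Option (Fin d)))).card := by
    rw [Fintype.card_subtype]; congr 1; ext k; simp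
  have h2 := Finset.card_sdiff_add_card_eq_card (Finset.subset_univ ({i, j} : Finset (Option (Fin d))))
  rw [Finset.card_pair h] at h2
  simp at h2
  omega

theorem lam_inj (L1 L2 : XT d →L[ℝ] ℝ) {i j : Option (Fin d)}
    (hdet : L1 (bv i) * L2 (bv j) - L1 (bv j) * L2 (bv i) ≠ 0) :
    ((L1 : XT d →ₗ[ℝ] ℝ).prod ((L2 : XT d →ₗ[ℝ] ℝ).prod (pr i j))).ker = ⊥ := by
  have hij : i ≠ j := by rintro rfl; exact hdet (by ring)
  rw [LinearMap.ker_eq_bot']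
  intro h hh
  have h1 : L1 h = 0 := congrArg Prod.fst hh
  have h2 : L2 h = 0 := congrArg (fun p => p.2.1) hh
  have h3 : pr i j h = 0 := congrArg (fun p => p.2.2) hh
  have hk : ∀ k, k ≠ i → k ≠ j → co k h = 0 := fun k hki hkj => congrFun h3 ⟨k, hki, hkj⟩
  have hsum : ∀ L : XT d →L[ℝ] ℝ, L h = co i h * L (bv i) + co j h * L (bv j) := by
    intro L
    rw [clm_co, ← Finset.sum_pair (f := fun k => co k h * L (bv k)) hij]
    symm
    refine Finset.sum_subset (Finset.subset_univ _) fun k _ hk' => ?_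
    simp only [Finset.mem_insert, Finset.mem_singleton, not_or] at hk'
    rw [hk k hk'.1 hk'.2, zero_mul]
  have h1' : co i h * L1 (bv i) + co j h * L1 (bv j) = 0 := by rw [← hsum]; exact h1
  have h2' : co i h * L2 (bv i) + co j h * L2 (bv j) = 0 := by rw [← hsum]; exact h2
  have hi : co i h = 0 := by
    have : co i h * (L1 (bv i) * L2 (bv j) - L1 (bv j) * L2 (bv i)) = 0 := by
      linear_combination L2 (bv j) * h1' - L1 (bv j) * h2'
    exact (mul_eq_zero.1 this).resolve_right hdet
  have hj : co j h = 0 := by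
    have : co j h * (L1 (bv i) * L2 (bv j) - L1 (bv j) * L2 (bv i)) = 0 := by
      linear_combination L1 (bv i) * h2' - L2 (bv i) * h1'
    exact (mul_eq_zero.1 this).resolve_right hdet
  refine co_ext fun k => ?_
  by_cases hki : k = i
  · rw [hki, hi]
  by_cases hkj : k = j
  · rw [hkj, hj]
  exact hk k hki hkj

/-- The projection of a set on which `z` is a Hölder function of `(π z, τ)`. -/
theorem holder_dim {i j : Option (Fin d)} (hij : i ≠ j) {Q : Set (XT d × ℝ)} {C s : ℝ} (hC0 : 0 ≤ C) (hs : 0 < s) (hs1 : s ≤ 1)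
    (hQ : ∀ q ∈ Q, ∀ q' ∈ Q, ‖pr i j (q.1 - q'.1)‖ ≤ 1)
    (h : ∀ q ∈ Q, ∀ q' ∈ Q, ‖q.1 - q'.1‖ ≤ C * (‖pr i j (q.1 - q'.1)‖ + |q.2 - q'.2| ^ s)) :
    dimH (Prod.fst '' Q) ≤ (d : ENNReal) / ENNReal.ofReal s := by
  classical
  set Φ : XT d × ℝ → (Kij i j → ℝ) × ℝ := fun q => (pr i j q.1, q.2) with hΦ
  have key : ∀ q ∈ Q, ∀ q' ∈ Q, dist q.1 q'.1 ≤ 2 * C * dist (Φ q) (Φ q') ^ s := by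
    intro q hq q' hq'
    rw [dist_eq_norm]
    refine (h q hq q' hq').trans ?_
    have h1 : ‖pr i j (q.1 - q'.1)‖ ≤ dist (Φ q) (Φ q') ^ s := by
      have e1 : ‖pr i j (q.1 - q'.1)‖ ≤ dist (Φ q) (Φ q') := by
        rw [map_sub, ← dist_eq_norm]; exact le_max_left _ _
      calc ‖pr i j (q.1 - q'.1)‖ ≤ ‖pr i j (q.1 - q'.1)‖ ^ s := by
            conv_lhs => rw [← Real.rpow_one ‖pr i j (q.1 - q'.1)‖]
            exact Real.rpow_le_rpow_of_exponent_ge' (norm_nonneg _) (hQ q hq q' hq') hs.le hs1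
        _ ≤ _ := by gcongr
    have h2 : |q.2 - q'.2| ^ s ≤ dist (Φ q) (Φ q') ^ s := by
      gcongr
      rw [← Real.dist_eq]; exact le_max_right _ _
    nlinarith
  rcases Q.eq_empty_or_nonempty with rfl | ⟨q0, hq0⟩
  · simp
  set g : (Kij i j → ℝ) × ℝ → XT d := fun y => (Function.invFunOn Φ Q y).1 with hg
  have hinv : ∀ q ∈ Q, Function.invFunOn Φ Q (Φ q) ∈ Q ∧ Φ (Function.invFunOn Φ Q (Φ q)) = Φ q := fun q hq =>
    ⟨Function.invFunOn_mem ⟨q, hq, rfl⟩, Function.invFunOn_eq ⟨q, hq, rfl⟩⟩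
  have hgq : ∀ q ∈ Q, g (Φ q) = q.1 := by
    intro q hq
    have := key _ (hinv q hq).1 q hq
    rw [(hinv q hq).2, dist_self, Real.zero_rpow hs.ne', mul_zero] at this
    exact dist_le_zero.1 this
  have himg : Prod.fst '' Q = g '' (Φ '' Q) := by
    rw [image_image]
    exact image_congr fun q hq => (hgq q hq).symm
  have hh : HolderOnWith (2 * C).toNNReal s.toNNReal g (Φ '' Q) := by
    rintro _ ⟨q, hq, rfl⟩ _ ⟨q', hq', rfl⟩
    rw [hgq q hq, hgq q' hq', edist_dist, edist_dist, Real.coe_toNNReal _ hs.le,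
      ENNReal.ofReal_rpow_of_nonneg dist_nonneg hs.le]
    change _ ≤ ENNReal.ofReal (2 * C) * _
    rw [← ENNReal.ofReal_mul (by positivity)]
    exact ENNReal.ofReal_le_ofReal (key q hq q' hq')
  have hd := hh.dimH_image_le (by simpa using hs)
  rw [himg]
  refine hd.trans ?_
  gcongr
  · refine (dimH_mono (subset_univ _)).trans ?_
    rw [Real.dimH_univ_eq_finrank]
    simp only [Module.finrank_prod, Module.finrank_self, Module.finrank_fintype_fun_eq_card]
    rw [Kij_card hij]
  · rfl

end geo


section dims
variable {d : ℕ}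

theorem lindelof_dim {P : Set (XT d × ℝ)} {D : ENNReal}
    (h : ∀ p ∈ P, ∃ V ∈ nhds p, dimH (Prod.fst '' (P ∩ V)) ≤ D) : dimH (Prod.fst '' P) ≤ D := by
  choose! V hV hD using h
  obtain ⟨t, htP, htc, hcov⟩ := TopologicalSpace.countable_cover_nhdsWithin
    (fun p hp => mem_nhdsWithin_of_mem_nhds (hV p hp))
  have hsub : Prod.fst '' P ⊆ ⋃ p ∈ t, Prod.fst '' (P ∩ V p) := by
    rintro _ ⟨q, hq, rfl⟩
    obtain ⟨p, hp, hqp⟩ := mem_iUnion₂.1 (hcov hq)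
    exact mem_iUnion₂.2 ⟨p, hp, q, ⟨hq, hqp⟩, rfl⟩
  refine (dimH_mono hsub).trans ?_
  rw [dimH_bUnion htc]
  exact iSup₂_le fun p hp => hD p (htP hp)

theorem piece_dim {O : Set (XT d)} (hO : IsOpen O) {w1 w2 : ℝ → XT d → ℝ} {T : Set ℝ}
    (sw1 : ∀ τ ∈ T, Sm (w1 τ) O) (sw2 : ∀ τ ∈ T, Sm (w2 τ) O)
    {Bl : Set (XT d)} (hBo : IsOpen Bl) (hBO : Bl ⊆ O) {C s : ℝ} (hC0 : 0 ≤ C) (hs : 0 < s) (hs1 : s ≤ 1)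
    (hC1 : ∀ τ ∈ T, ∀ τ' ∈ T, ∀ z ∈ Bl, |w1 τ z - w1 τ' z| ≤ C * |τ - τ'| ^ s)
    (hCd1 : ∀ i, ∀ τ ∈ T, ∀ τ' ∈ T, ∀ z ∈ Bl, |dd i (w1 τ) z - dd i (w1 τ') z| ≤ C * |τ - τ'| ^ s)
    (hC2 : ∀ τ ∈ T, ∀ τ' ∈ T, ∀ z ∈ Bl, |w2 τ z - w2 τ' z| ≤ C * |τ - τ'| ^ s)
    (hCd2 : ∀ i, ∀ τ ∈ T, ∀ τ' ∈ T, ∀ z ∈ Bl, |dd i (w2 τ) z - dd i (w2 τ') z| ≤ C * |τ - τ'| ^ s)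
    {i j : Option (Fin d)} {P : Set (XT d × ℝ)}
    (hP : ∀ p ∈ P, p.1 ∈ Bl ∧ p.2 ∈ T ∧ w1 p.2 p.1 = 0 ∧ w2 p.2 p.1 = 0 ∧
      dd i (w1 p.2) p.1 * dd j (w2 p.2) p.1 - dd j (w1 p.2) p.1 * dd i (w2 p.2) p.1 ≠ 0) :
    dimH (Prod.fst '' P) ≤ (d : ENNReal) / ENNReal.ofReal s := by
  refine lindelof_dim fun p hp => ?_
  obtain ⟨hpB, hpT, hp1, hp2, hdet⟩ := hP p hp
  have hij : i ≠ j := by rintro rfl; exact hdet (by ring)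
  obtain ⟨K, hK, hanti⟩ := LinearMap.exists_antilipschitzWith _
    (lam_inj (fderiv ℝ (w1 p.2) p.1) (fderiv ℝ (w2 p.2) p.1) hdet)
  have hKp : (0:ℝ) < K := by exact_mod_cast hK
  have hε : (0:ℝ) < 1 / (4 * K) := by positivity
  obtain ⟨V1, hV1, h1⟩ := lin_est hO sw1 hBo hBO hs hC1 hCd1 hpB hpT hε
  obtain ⟨V2, hV2, h2⟩ := lin_est hO sw2 hBo hBO hs hC2 hCd2 hpB hpT hε
  have hpc : Continuous (fun q : XT d × ℝ => pr i j q.1) :=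
    (LinearMap.continuous_of_finiteDimensional (pr i j)).comp continuous_fst
  have hV3 : {q : XT d × ℝ | dist (pr i j q.1) (pr i j p.1) < 1 / 2} ∈ nhds p :=
    Metric.tendsto_nhds.1 hpc.continuousAt (1 / 2) (by norm_num)
  refine ⟨V1 ∩ V2 ∩ {q : XT d × ℝ | dist (pr i j q.1) (pr i j p.1) < 1 / 2},
    Filter.inter_mem (Filter.inter_mem hV1 hV2) hV3, ?_⟩
  refine holder_dim hij (C := 2 * K * (2 * C + 1)) (by positivity) hs hs1 ?_ ?_
  · rintro q ⟨_, _, hq⟩ q' ⟨_, _, hq'⟩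
    rw [map_sub, ← dist_eq_norm]
    have := dist_triangle_right (pr i j q.1) (pr i j q'.1) (pr i j p.1)
    have e1 : dist (pr i j q.1) (pr i j p.1) < 1 / 2 := hq
    have e2 : dist (pr i j q'.1) (pr i j p.1) < 1 / 2 := hq'
    linarith
  · rintro q ⟨hqP, ⟨hq1, hq2⟩, _⟩ q' ⟨hqP', ⟨hq1', hq2'⟩, _⟩
    obtain ⟨-, hqT, hqw1, hqw2, -⟩ := hP q hqP
    obtain ⟨-, hqT', hqw1', hqw2', -⟩ := hP q' hqP'
    have a1 := h1 q hq1 q' hq1' hqT hqT' hqw1 hqw1'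
    have a2 := h2 q hq2 q' hq2' hqT hqT' hqw2 hqw2'
    have a3 := hanti.le_mul_dist q.1 q'.1
    rw [dist_eq_norm, dist_eq_norm, ← map_sub] at a3
    set h := q.1 - q'.1 with hh
    have a4 : ‖((fderiv ℝ (w1 p.2) p.1 : XT d →ₗ[ℝ] ℝ).prod ((fderiv ℝ (w2 p.2) p.1 : XT d →ₗ[ℝ] ℝ).prod (pr i j))) h‖
        ≤ |fderiv ℝ (w1 p.2) p.1 h| + |fderiv ℝ (w2 p.2) p.1 h| + ‖pr i j h‖ := by
      have b1 := abs_nonneg (fderiv ℝ (w1 p.2) p.1 h)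
      have b2 := abs_nonneg (fderiv ℝ (w2 p.2) p.1 h)
      have b3 := norm_nonneg (pr i j h)
      refine max_le ?_ (max_le ?_ ?_)
      · change |fderiv ℝ (w1 p.2) p.1 h| ≤ _
        linarith
      · change |fderiv ℝ (w2 p.2) p.1 h| ≤ _
        linarith
      · change ‖pr i j h‖ ≤ _
        linarith
    set X := |q.2 - q'.2| ^ s with hX
    have hX0 : 0 ≤ X := by positivity
    have a5 : ‖h‖ ≤ K * (2 * (1 / (4 * K) * ‖h‖ + C * X) + ‖pr i j h‖) := by
      refine a3.trans ?_
      gcongr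
      linarith
    have a6 : K * (2 * (1 / (4 * K) * ‖h‖ + C * X) + ‖pr i j h‖) = ‖h‖ / 2 + K * (2 * C * X + ‖pr i j h‖) := by
      field_simp
      ring
    rw [a6] at a5
    have b3 := norm_nonneg (pr i j h)
    have a7 : 2 * C * X + ‖pr i j h‖ ≤ (2 * C + 1) * (‖pr i j h‖ + X) := by nlinarith [mul_nonneg hC0 b3]
    have a8 := mul_le_mul_of_nonneg_left a7 hKp.le
    linarith

theorem dim_main {O : Set (XT d)} (hO : IsOpen O) {J : Set ℝ} {f : ℝ → XT d → ℝ}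
    (sf : ∀ τ ∈ J, Sm (f τ) O)
    (hlip : ∀ z0 ∈ O, ∀ τ0 ∈ J, ∃ ρ > 0, ∃ L : ℝ, 0 ≤ L ∧ Metric.closedBall z0 ρ ⊆ O ∧
      Metric.ball τ0 ρ ⊆ J ∧ ∀ τ ∈ Metric.ball τ0 ρ, ∀ τ' ∈ Metric.ball τ0 ρ,
        ∀ z ∈ Metric.closedBall z0 ρ, |f τ z - f τ' z| ≤ L * |τ - τ'|)
    {S : Set (XT d × ℝ)}
    (hS : ∀ p ∈ S, p.1 ∈ O ∧ p.2 ∈ J ∧ ∃ l1 l2 : List (Option (Fin d)), ∃ i j,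
      dw l1 (f p.2) p.1 = 0 ∧ dw l2 (f p.2) p.1 = 0 ∧
      dw (i :: l1) (f p.2) p.1 * dw (j :: l2) (f p.2) p.1
        - dw (j :: l1) (f p.2) p.1 * dw (i :: l2) (f p.2) p.1 ≠ 0)
    {s : ℝ} (hs : 0 < s) (hs1 : s < 1) :
    dimH (Prod.fst '' S) ≤ (d : ENNReal) / ENNReal.ofReal s := by
  refine lindelof_dim ?_
  rintro ⟨z0, τ0⟩ hp
  obtain ⟨hz0, hτ0, -⟩ := hS _ hp
  obtain ⟨ρ, hρ, L, hL0, hρO, hρJ, hL⟩ := hlip z0 hz0 τ0 hτ0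
  set r := min ρ (1 / 2) with hr
  have hrp : 0 < r := by positivity
  refine ⟨Metric.ball z0 (ρ / 2) ×ˢ Metric.ball τ0 r,
    prod_mem_nhds (Metric.ball_mem_nhds _ (by positivity)) (Metric.ball_mem_nhds _ hrp), ?_⟩
  have hrρ : Metric.ball τ0 r ⊆ Metric.ball τ0 ρ := Metric.ball_subset_ball (min_le_left _ _)
  let k0 : List (Option (Fin d)) → List (Option (Fin d)) → ℕ := fun l1 l2 => l1.length + l2.length + 1
  let η : List (Option (Fin d)) → List (Option (Fin d)) → ℝ := fun l1 l2 => (1 - s) / k0 l1 l2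
  let m : List (Option (Fin d)) → List (Option (Fin d)) → ℕ := fun l1 l2 => ⌈1 / η l1 l2⌉₊
  let T : List (Option (Fin d)) → List (Option (Fin d)) → ℕ → Set ℝ := fun l1 l2 n =>
    {τ | τ ∈ Metric.ball τ0 r ∧ ∀ l : List (Option (Fin d)), l.length ≤ k0 l1 l2 + m l1 l2 →
      ∀ z ∈ Metric.closedBall z0 ρ, |dw l (f τ) z| ≤ n}
  let Pc : List (Option (Fin d)) × List (Option (Fin d)) × Option (Fin d) × Option (Fin d) × ℕ →
    Set (XT d × ℝ) := fun a => {p | p.1 ∈ Metric.ball z0 (ρ / 2) ∧ p.2 ∈ T a.1 a.2.1 a.2.2.2.2 ∧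
      dw a.1 (f p.2) p.1 = 0 ∧ dw a.2.1 (f p.2) p.1 = 0 ∧
      dw (a.2.2.1 :: a.1) (f p.2) p.1 * dw (a.2.2.2.1 :: a.2.1) (f p.2) p.1
        - dw (a.2.2.2.1 :: a.1) (f p.2) p.1 * dw (a.2.2.1 :: a.2.1) (f p.2) p.1 ≠ 0}
  have hcov : Prod.fst '' (S ∩ Metric.ball z0 (ρ / 2) ×ˢ Metric.ball τ0 r) ⊆ ⋃ a, Prod.fst '' (Pc a) := by
    rintro _ ⟨p, ⟨hpS, hpz, hpτ⟩, rfl⟩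
    obtain ⟨_, hpJ, l1, l2, i, j, h1, h2, h3⟩ := hS p hpS
    have : ∀ l : List (Option (Fin d)), ∃ c : ℝ, ∀ z ∈ Metric.closedBall z0 ρ, |dw l (f p.2) z| ≤ c := fun l =>
      (isCompact_closedBall z0 ρ).exists_bound_of_continuousOn
        (((sf p.2 hpJ).dw hO l).continuousOn.mono hρO)
    choose c hc using this
    obtain ⟨B, hB⟩ := ((List.finite_length_le (Option (Fin d)) (k0 l1 l2 + m l1 l2)).image c).bddAbove
    obtain ⟨n, hn⟩ := exists_nat_ge B
    refine mem_iUnion.2 ⟨(l1, l2, i, j, n), p, ⟨hpz, ⟨hpτ, fun l hl z hz => ?_⟩, h1, h2, h3⟩, rfl⟩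
    exact (hc l z hz).trans ((hB ⟨l, hl, rfl⟩).trans hn)
  refine (dimH_mono hcov).trans ?_
  rw [dimH_iUnion]
  refine iSup_le ?_
  rintro ⟨l1, l2, i, j, n⟩
  have hTJ : ∀ τ ∈ T l1 l2 n, τ ∈ J := fun τ hτ => hρJ (hrρ hτ.1)
  have hk0 : (0:ℝ) < k0 l1 l2 := by simp only [k0]; positivity
  have hη : 0 < η l1 l2 := div_pos (by linarith) hk0
  have hmc : 1 / η l1 l2 ≤ m l1 l2 := Nat.le_ceil _
  have hm1 : 1 ≤ m l1 l2 := Nat.one_le_ceil_iff.2 (by positivity)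
  have hmη : 1 ≤ η l1 l2 * m l1 l2 := by
    rw [div_le_iff₀ hη] at hmc; linarith
  have hT1 : ∀ τ ∈ T l1 l2 n, ∀ τ' ∈ T l1 l2 n, |τ - τ'| ≤ 1 := by
    intro τ hτ τ' hτ'
    have e1 : dist τ τ0 < 1 / 2 := lt_of_lt_of_le hτ.1 (min_le_right _ _)
    have e2 : dist τ' τ0 < 1 / 2 := lt_of_lt_of_le hτ'.1 (min_le_right _ _)
    rw [← Real.dist_eq]
    linarith [dist_triangle_right τ τ' τ0]
  have hold : ∀ l : List (Option (Fin d)), ∃ C : ℝ, 0 ≤ C ∧ (l.length ≤ k0 l1 l2 → ∀ τ ∈ T l1 l2 n, ∀ τ' ∈ T l1 l2 n,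
      ∀ z ∈ Metric.ball z0 (ρ / 2), |dw l (f τ) z - dw l (f τ') z| ≤ C * |τ - τ'| ^ s) := by
    intro l
    by_cases hl : l.length ≤ k0 l1 l2
    · obtain ⟨C, hC0, hC⟩ := word_holder hO (f := f) (T := T l1 l2 n) (fun τ hτ => sf τ (hTJ τ hτ)) (z0 := z0) (ρ := ρ)
        (η := η l1 l2) (m := m l1 l2) (N := k0 l1 l2 + m l1 l2) hm1 hmη hη (B := n) (L := L) (by positivity) hL0 hρO
        (fun τ hτ => hτ.2) hT1 (fun τ hτ τ' hτ' => hL τ (hrρ hτ.1) τ' (hrρ hτ'.1)) l (by omega) (ρ / 2) (by linarith)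
      refine ⟨C, hC0, fun _ τ hτ τ' hτ' z hz => (hC τ hτ τ' hτ' z (Metric.ball_subset_closedBall hz)).trans ?_⟩
      refine mul_le_mul_of_nonneg_left ?_ hC0
      refine Real.rpow_le_rpow_of_exponent_ge' (abs_nonneg _) (hT1 τ hτ τ' hτ') hs.le ?_
      have e1 : (l.length : ℝ) * η l1 l2 ≤ k0 l1 l2 * η l1 l2 := by gcongr
      have e2 : (k0 l1 l2 : ℝ) * η l1 l2 = 1 - s := by
        change (k0 l1 l2 : ℝ) * ((1 - s) / k0 l1 l2) = 1 - s
        field_simp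
      linarith
    · exact ⟨0, le_rfl, fun h => absurd h hl⟩
  choose C hC0 hC using hold
  set Ct := C l1 + C l2 + ∑ i, (C (i :: l1) + C (i :: l2)) with hCt
  have hsn : 0 ≤ ∑ i, (C (i :: l1) + C (i :: l2)) := Finset.sum_nonneg fun i _ => add_nonneg (hC0 _) (hC0 _)
  have hss : ∀ i, C (i :: l1) + C (i :: l2) ≤ ∑ i, (C (i :: l1) + C (i :: l2)) := fun i =>
    Finset.single_le_sum (f := fun i => C (i :: l1) + C (i :: l2)) (fun i _ => add_nonneg (hC0 _) (hC0 _)) (Finset.mem_univ i)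
  have hb1 : C l1 ≤ Ct := by linarith [hC0 l1, hC0 l2]
  have hb2 : C l2 ≤ Ct := by linarith [hC0 l1, hC0 l2]
  have hb3 : ∀ i, C (i :: l1) ≤ Ct := fun i => by linarith [hC0 l1, hC0 l2, hss i, hC0 (i :: l1), hC0 (i :: l2)]
  have hb4 : ∀ i, C (i :: l2) ≤ Ct := fun i => by linarith [hC0 l1, hC0 l2, hss i, hC0 (i :: l1), hC0 (i :: l2)]
  have up : ∀ {c x : ℝ} {Δ : ℝ}, x ≤ c * |Δ| ^ s → c ≤ Ct → x ≤ Ct * |Δ| ^ s := fun h1 h2 =>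
    h1.trans (by gcongr)
  refine piece_dim hO (w1 := fun τ => dw l1 (f τ)) (w2 := fun τ => dw l2 (f τ)) (T := T l1 l2 n)
    (fun τ hτ => (sf τ (hTJ τ hτ)).dw hO l1) (fun τ hτ => (sf τ (hTJ τ hτ)).dw hO l2)
    (Bl := Metric.ball z0 (ρ / 2)) Metric.isOpen_ball ?_ (C := Ct) ((hC0 l1).trans hb1) hs hs1.le ?_ ?_ ?_ ?_
    (i := i) (j := j) (fun p hp => hp)
  · exact (Metric.ball_subset_closedBall.trans (Metric.closedBall_subset_closedBall (by linarith))).trans hρO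
  · exact fun τ hτ τ' hτ' z hz => up (hC l1 (by simp only [k0]; omega) τ hτ τ' hτ' z hz) hb1
  · exact fun i τ hτ τ' hτ' z hz => up (hC (i :: l1) (by simp only [k0, List.length_cons]; omega) τ hτ τ' hτ' z hz) (hb3 i)
  · exact fun τ hτ τ' hτ' z hz => up (hC l2 (by simp only [k0]; omega) τ hτ τ' hτ' z hz) hb2
  · exact fun i τ hτ τ' hτ' z hz => up (hC (i :: l2) (by simp only [k0, List.length_cons]; omega) τ hτ τ' hτ' z hz) (hb4 i)

end dims


/-- Purely topological/dimension-theoretic final step. -/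
theorem generic_of_dim {d : ℕ} (hd : 2 ≤ d) {O : Set (XT d)} (hO : IsOpen O) {J : Set ℝ}
    (hJ : IsOpen J) {G : XT d × ℝ → ℝ × (Fin d → ℝ)} (hG : ContinuousOn G (O ×ˢ J))
    (hdim : ∀ s : ℝ, 0 < s → s < 1 →
      dimH (Prod.fst '' {p : XT d × ℝ | p ∈ O ×ˢ J ∧ G p = 0}) ≤ (d : ENNReal) / ENNReal.ofReal s) :
    ∃ F : ℕ → Set (XT d), (∀ n, IsOpen (F n) ∧ F n ⊆ O ∧ O ⊆ closure (F n)) ∧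
      ∀ q ∈ ⋂ n, F n, ¬ ∃ τ ∈ J, G (q, τ) = 0 := by
  obtain ⟨K, hKc, hKU, hKun, hmono⟩ := (hO.prod hJ).exists_iUnion_isClosed
  set P : ℕ → Set (XT d × ℝ) := fun n => (K n ∩ G ⁻¹' {0}) ∩ Metric.closedBall 0 n with hP
  have hPc : ∀ n, IsCompact (P n) := fun n =>
    (isCompact_closedBall _ _).inter_left
      ((hG.mono (hKU n)).preimage_isClosed_of_isClosed (hKc n) isClosed_singleton)
  have hlt : dimH (Prod.fst '' {p : XT d × ℝ | p ∈ O ×ˢ J ∧ G p = 0}) < ((d + 1 : ℕ) : ENNReal) := by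
    have hd0 : (0 : ℝ) < d := by exact_mod_cast (by omega : 0 < d)
    have hs : (0 : ℝ) < (2 * d + 1) / (2 * d + 2) := by positivity
    refine (hdim ((2 * d + 1) / (2 * d + 2)) hs ?_).trans_lt ?_
    · rw [div_lt_one (by positivity)]; linarith
    · rw [← ENNReal.ofReal_natCast d, ← ENNReal.ofReal_natCast (d + 1), ← ENNReal.ofReal_div_of_pos hs]
      rw [ENNReal.ofReal_lt_ofReal_iff (by positivity), div_lt_iff₀ hs]
      push_cast
      have : ((d : ℝ) + 1) * ((2 * d + 1) / (2 * d + 2)) = d + 1 / 2 := by field_simp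
      linarith
  have hfr : Module.finrank ℝ (XT d) = d + 1 := by simp [XT]
  have hden : Dense (Prod.fst '' {p : XT d × ℝ | p ∈ O ×ˢ J ∧ G p = 0})ᶜ :=
    dense_compl_of_dimH_lt_finrank (by rw [hfr]; exact hlt)
  refine ⟨fun n => O ∩ (Prod.fst '' P n)ᶜ, fun n => ⟨?_, inter_subset_left, ?_⟩, ?_⟩
  · exact hO.inter ((hPc n).image continuous_fst).isClosed.isOpen_compl
  · refine (Dense.mono ?_ hden).open_subset_closure_inter hO
    refine compl_subset_compl.2 (image_mono ?_)
    rintro p ⟨⟨h1, h2⟩, -⟩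
    exact ⟨hKU n h1, h2⟩
  · rintro q hq ⟨τ, hτ, h0⟩
    rw [mem_iInter] at hq
    have hqO : q ∈ O := (hq 0).1
    have hm : (q, τ) ∈ ⋃ n, K n := by rw [hKun]; exact ⟨hqO, hτ⟩
    obtain ⟨n, hn⟩ := mem_iUnion.1 hm
    obtain ⟨m, hm⟩ := exists_nat_ge ‖(q, τ)‖
    refine (hq (max n m)).2 ⟨(q, τ), ⟨⟨hmono (le_max_left n m) hn, h0⟩, ?_⟩, rfl⟩
    rw [mem_closedBall_zero_iff]
    refine hm.trans ?_
    exact_mod_cast le_max_right n m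

/-- Local Lipschitz bounds in the parameter. -/
theorem lip_of_contDiff {d : ℕ} {O : Set (XT d)} (hO : IsOpen O) {J : Set ℝ}
    (hJ : IsOpen J) {W : XT d × ℝ → ℝ} (hW : ContDiffOn ℝ 1 W (O ×ˢ J)) :
    ∀ z0 ∈ O, ∀ τ0 ∈ J, ∃ ρ > 0, ∃ L : ℝ, 0 ≤ L ∧ Metric.closedBall z0 ρ ⊆ O ∧
      Metric.ball τ0 ρ ⊆ J ∧ ∀ τ ∈ Metric.ball τ0 ρ, ∀ τ' ∈ Metric.ball τ0 ρ,
        ∀ z ∈ Metric.closedBall z0 ρ, |W (z, τ) - W (z, τ')| ≤ L * |τ - τ'| := by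
  intro z0 hz0 τ0 hτ0
  have hU := hO.prod hJ
  have hm : O ×ˢ J ∈ nhds (z0, τ0) := hU.mem_nhds ⟨hz0, hτ0⟩
  obtain ⟨L, t, ht, hL⟩ := (hW.contDiffAt hm).exists_lipschitzOnWith
  obtain ⟨ρ, hρ, hρt⟩ := Metric.nhds_basis_closedBall.mem_iff.1 (Filter.inter_mem hm ht)
  have key : ∀ z ∈ Metric.closedBall z0 ρ, ∀ τ ∈ Metric.closedBall τ0 ρ, (z, τ) ∈ O ×ˢ J ∩ t := by
    intro z hz τ hτ
    apply hρt
    rw [← closedBall_prod_same]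
    exact ⟨hz, hτ⟩
  refine ⟨ρ, hρ, L, L.2, fun z hz => (key z hz τ0 (Metric.mem_closedBall_self hρ.le)).1.1,
    fun τ hτ => (key z0 (Metric.mem_closedBall_self hρ.le) τ (Metric.ball_subset_closedBall hτ)).1.2, ?_⟩
  intro τ hτ τ' hτ' z hz
  have := hL.dist_le_mul _ (key z hz τ (Metric.ball_subset_closedBall hτ)).2 _
    (key z hz τ' (Metric.ball_subset_closedBall hτ')).2
  simpa [Real.dist_eq, Prod.dist_eq] using this

/-- The coordinate derivatives depend continuously on all the variables. -/
theorem pd_eq_joint {d : ℕ} {W : XT d × ℝ → ℝ} {p : XT d × ℝ} (hW : DifferentiableAt ℝ W p) (i : Fin d) :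
    pd i (fun y => W ((y, p.1.2), p.2)) p.1.1 = fderiv ℝ W p ((Pi.single i 1, 0), 0) := by
  obtain ⟨⟨x, t⟩, τ⟩ := p
  have h2 : HasFDerivAt (fun y : Fin d → ℝ => (((y, t), τ) : XT d × ℝ))
      ((ContinuousLinearMap.inl ℝ (XT d) ℝ).comp (ContinuousLinearMap.inl ℝ (Fin d → ℝ) ℝ)) x :=
    HasFDerivAt.comp (g := fun z : XT d => (z, τ)) (f := fun y : Fin d → ℝ => ((y, t) : XT d)) x
      (hasFDerivAt_prodMk_left (x, t) τ) (hasFDerivAt_prodMk_left x t)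
  have h1 : HasFDerivAt (fun y : Fin d → ℝ => W ((y, t), τ)) _ x :=
    HasFDerivAt.comp (f := fun y : Fin d → ℝ => (((y, t), τ) : XT d × ℝ)) x hW.hasFDerivAt h2
  simp only [pd]
  rw [h1.fderiv]
  simp

/-- Theorem `th-Intro-nodalset` part 2: the set of points `(x₀,t₀)`
at which no parameter `τ` produces a singular zero of `v` is generic (residual) in
`Ω × I`: it contains a countable intersection of dense open subsets of `Ω × I`. -/
theorem singular_nodal_set_projection_generic
    (d : ℕ) (hd : 2 ≤ d)
    (Ω : Set (Fin d → ℝ)) (hΩo : IsOpen Ω) (hΩc : IsConnected Ω)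
    (hΩb : Bornology.IsBounded Ω)
    (I J : Set ℝ) (hIo : IsOpen I) (hIc : I.OrdConnected)
    (hJo : IsOpen J) (hJc : J.OrdConnected)
    (a : (Fin d → ℝ) → ℝ → ℝ → ℝ) (b : (Fin d → ℝ) → ℝ → ℝ → Fin d → ℝ)
    (ha : ContDiffOn ℝ (⊤ : ℕ∞)
      (fun q : (Fin d → ℝ) × ℝ × ℝ => a q.1 q.2.1 q.2.2) (Ω ×ˢ (I ×ˢ J)))
    (hb : ContDiffOn ℝ (⊤ : ℕ∞)
      (fun q : (Fin d → ℝ) × ℝ × ℝ => b q.1 q.2.1 q.2.2) (Ω ×ˢ (I ×ˢ J)))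
    (hab : ∃ C : ℝ, ∀ x ∈ Ω, ∀ t ∈ I, ∀ τ ∈ J, |a x t τ| ≤ C ∧ ‖b x t τ‖ ≤ C)
    (r : ℕ) (hr : 1 ≤ r)
    (v : (Fin d → ℝ) → ℝ → ℝ → ℝ)
    (hv_xt : ∀ τ ∈ J, ContDiffOn ℝ (⊤ : ℕ∞)
      (fun q : (Fin d → ℝ) × ℝ => v q.1 q.2 τ) (Ω ×ˢ I))
    (hv_r : ContDiffOn ℝ r
      (fun q : (Fin d → ℝ) × ℝ × ℝ => v q.1 q.2.1 q.2.2) (Ω ×ˢ (I ×ˢ J)))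
    (hv_cont : ∀ τ ∈ J, ContinuousOn
      (fun q : (Fin d → ℝ) × ℝ => v q.1 q.2 τ) (closure Ω ×ˢ I))
    (hv_bc : ∀ τ ∈ J, ∀ x ∈ frontier Ω, ∀ t ∈ I, v x t τ = 0)
    (hv_eq : ∀ τ ∈ J, ∀ x ∈ Ω, ∀ t ∈ I,
      deriv (fun s => v x s τ) t
        = lap (fun y => v y t τ) x + a x t τ * v x t τ
          + ∑ i, b x t τ i * pd i (fun y => v y t τ) x)
    (hv_nt : ¬ ∃ t ∈ I, ∃ τ ∈ J, ∀ x ∈ Ω, v x t τ = 0) :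
    ∃ F : ℕ → Set ((Fin d → ℝ) × ℝ),
      (∀ n, IsOpen (F n) ∧ F n ⊆ Ω ×ˢ I ∧ Ω ×ˢ I ⊆ closure (F n)) ∧
      (⋂ n, F n) ⊆ {q : (Fin d → ℝ) × ℝ |
        ¬ ∃ τ ∈ J, v q.1 q.2 τ = 0 ∧ ∀ i, pd i (fun y => v y q.2 τ) q.1 = 0} := by
  have hO : IsOpen (Ω ×ˢ I) := hΩo.prod hIo
  set f : ℝ → XT d → ℝ := fun τ q => v q.1 q.2 τ with hf
  set W : XT d × ℝ → ℝ := fun p => v p.1.1 p.1.2 p.2 with hWdef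
  have sf : ∀ τ ∈ J, Sm (f τ) (Ω ×ˢ I) := hv_xt
  have sa : ∀ τ ∈ J, Sm (fun q : XT d => a q.1 q.2 τ) (Ω ×ˢ I) := fun τ hτ =>
    ha.comp (f := fun q : XT d => (q.1, q.2, τ)) (ContDiff.contDiffOn (by fun_prop)) fun q hq => ⟨hq.1, hq.2, hτ⟩
  have sb : ∀ τ ∈ J, ∀ i, Sm (fun q : XT d => b q.1 q.2 τ i) (Ω ×ˢ I) := fun τ hτ i =>
    (contDiffOn_pi.1 hb i).comp (f := fun q : XT d => (q.1, q.2, τ)) (ContDiff.contDiffOn (by fun_prop))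
      fun q hq => ⟨hq.1, hq.2, hτ⟩
  have hW : ContDiffOn ℝ 1 W ((Ω ×ˢ I) ×ˢ J) :=
    (hv_r.of_le (by exact_mod_cast hr)).comp (f := fun p : XT d × ℝ => (p.1.1, p.1.2, p.2))
      (ContDiff.contDiffOn (by fun_prop)) fun p hp => ⟨hp.1.1, hp.1.2, hp.2⟩
  have hpd : ∀ τ ∈ J, ∀ x ∈ Ω, ∀ t ∈ I, ∀ i, pd i (fun y => v y t τ) x = dd (some i) (f τ) (x, t) :=
    fun τ hτ x hx t ht i => fderiv_slice (f := f τ) ((sf τ hτ).diffAt hO ⟨hx, ht⟩) i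
  have hpde : ∀ τ ∈ J, PDE (f τ) (fun q : XT d => a q.1 q.2 τ) (fun i q => b q.1 q.2 τ i) (Ω ×ˢ I) := by
    rintro τ hτ ⟨x, t⟩ ⟨hx, ht⟩
    have e := hv_eq τ hτ x hx t ht
    have e1 : deriv (fun s => v x s τ) t = dd none (f τ) (x, t) :=
      (hasDerivAt_slice (f := f τ) ((sf τ hτ).diffAt hO ⟨hx, ht⟩)).deriv
    have e2 : lap (fun y => v y t τ) x = ∑ i, dd (some i) (dd (some i) (f τ)) (x, t) := by
      refine Finset.sum_congr rfl fun i _ => ?_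
      rw [← fderiv_slice (((sf τ hτ).dd hO (some i)).diffAt hO ⟨hx, ht⟩) i]
      have : (pd i fun y => v y t τ) =ᶠ[nhds x] fun y => dd (some i) (f τ) (y, t) := by
        filter_upwards [hΩo.mem_nhds hx] with y hy using hpd τ hτ y hy t ht i
      change fderiv ℝ (pd i fun y => v y t τ) x _ = _
      rw [this.fderiv_eq]
    have e3 : ∀ i, pd i (fun y => v y t τ) x = dd (some i) (f τ) (x, t) := hpd τ hτ x hx t ht
    rw [e1, e2] at e
    simp only [e3] at e
    exact e
  set G : XT d × ℝ → ℝ × (Fin d → ℝ) :=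
    fun p => (W p, fun i => pd i (fun y => v y p.1.2 p.2) p.1.1) with hGdef
  have hU : IsOpen ((Ω ×ˢ I) ×ˢ J) := hO.prod hJo
  have hG : ContinuousOn G ((Ω ×ˢ I) ×ˢ J) := by
    refine hW.continuousOn.prodMk (continuousOn_pi.2 fun i => ?_)
    have hc := (hW.continuousOn_fderiv_of_isOpen hU le_rfl).clm_apply
      (continuousOn_const (c := (((Pi.single i 1, 0), 0) : XT d × ℝ)))
    refine hc.congr fun p hp => ?_
    exact pd_eq_joint ((hW.contDiffAt (hU.mem_nhds hp)).differentiableAt one_ne_zero) i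
  have hdim : ∀ s : ℝ, 0 < s → s < 1 →
      dimH (Prod.fst '' {p : XT d × ℝ | p ∈ (Ω ×ˢ I) ×ˢ J ∧ G p = 0}) ≤ (d : ENNReal) / ENNReal.ofReal s := by
    intro s hs hs1
    refine dim_main hO sf (lip_of_contDiff hO hJo hW) ?_ hs hs1
    rintro ⟨⟨x, t⟩, τ⟩ ⟨⟨⟨hx, ht⟩, hτ⟩, h0⟩
    simp only at hx ht hτ
    refine ⟨⟨hx, ht⟩, hτ, ?_⟩
    have h1 : f τ (x, t) = 0 := congrArg Prod.fst h0
    have h2 : ∀ i, dd (some i) (f τ) (x, t) = 0 := fun i => by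
      rw [← hpd τ hτ x hx t ht i]
      exact congrFun (congrArg Prod.snd h0) i
    have hnt : ∃ x ∈ Ω, f τ (x, t) ≠ 0 := by
      by_contra hcon
      push Not at hcon
      exact hv_nt ⟨t, ht, τ, hτ, hcon⟩
    exact two_words hO (sf τ hτ) (sa τ hτ) (sb τ hτ) (hpde τ hτ) ⟨hx, ht⟩ h1 h2
      (exists_word hΩo hΩc hIo (sf τ hτ) (sa τ hτ) (sb τ hτ) (hpde τ hτ) ht hnt hx)
  obtain ⟨F, hF1, hF2⟩ := generic_of_dim hd hO hJo hG hdim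
  refine ⟨F, hF1, fun q hq => ?_⟩
  rintro ⟨τ, hτ, h0, h1⟩
  exact hF2 q hq ⟨τ, hτ, Prod.ext h0 (funext h1)⟩
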